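/- In q-Web↑, for all h, k, l, r, s ≥ 0: (a) composing two successive rungs of thicknesses r and s in the same direction between a pair of adjacent vertical strands equals binom(r+s, s) times the single rung of thickness r+s; that is, on ↑_k↑_l, the composite of the ladder with one leftward rung of thickness r followed by the ladder with one leftward rung of thickness s equals binom(r+s,s) times the ladder with a single leftward rung of thickness r+s (and likewise with all rung orientations reversed); (b) on ↑_k↑_l, the sum of the two compositions of a thickness-1 rightward rung with a dot on the rung and a thickness-1 leftward rung with a dot on the rung (taken in the two possible orders) equals (k+l)·id_{↑_k↑_l}. -/

import Mathlib

noncomputable section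

/-- Objects of the web category `q-Web↑`: words of nonnegative integers. -/
abbrev WObj := List ℕ

/-- A model of the strict monoidal supercategory `q-Web↑` of Brown–Kujawa
(Definition 4.1 of "Webs of type Q"): a ℂ-linear supercategory with objects the
words of nonnegative integers, tensor product given by concatenation of words,
generating morphisms the (odd) dots, (even) merges and (even) splits, subject
to the defining web relations (associativity and coassociativity, digon
removal, dot collision, dots past merges/splits, the dumbbell relation and the
square switch relation), together with the `ℤ/2`-grading (parity) data making
it a supercategory with the super-interchange law. -/
structure QWebUp where
  Hom : WObj → WObj → ModuleCat.{0} ℂ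
  id : ∀ a : WObj, Hom a a
  comp : ∀ {a b c : WObj}, Hom a b → Hom b c → Hom a c
  tensor : ∀ {a b a' b' : WObj}, Hom a b → Hom a' b' → Hom (a ++ a') (b ++ b')
  dot : ∀ k : ℕ, Hom [k] [k]
  merge : ∀ k l : ℕ, Hom [k, l] [k + l]
  split : ∀ k l : ℕ, Hom [k + l] [k, l]
  par : ∀ a b : WObj, ZMod 2 → Submodule ℂ (Hom a b)
  /- ℂ-linear category axioms -/
  id_comp : ∀ {a b : WObj} (f : Hom a b), comp (id a) f = f
  comp_id : ∀ {a b : WObj} (f : Hom a b), comp f (id b) = f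
  comp_assoc : ∀ {a b c d : WObj} (f : Hom a b) (g : Hom b c) (h : Hom c d),
    comp (comp f g) h = comp f (comp g h)
  comp_add_left : ∀ {a b c : WObj} (f g : Hom a b) (h : Hom b c),
    comp (f + g) h = comp f h + comp g h
  comp_add_right : ∀ {a b c : WObj} (f : Hom a b) (g h : Hom b c),
    comp f (g + h) = comp f g + comp f h
  comp_smul_left : ∀ {a b c : WObj} (z : ℂ) (f : Hom a b) (h : Hom b c),
    comp (z • f) h = z • comp f h
  comp_smul_right : ∀ {a b c : WObj} (z : ℂ) (f : Hom a b) (h : Hom b c),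
    comp f (z • h) = z • comp f h
  tensor_add_left : ∀ {a b a' b' : WObj} (f g : Hom a b) (h : Hom a' b'),
    tensor (f + g) h = tensor f h + tensor g h
  tensor_add_right : ∀ {a b a' b' : WObj} (f : Hom a b) (g h : Hom a' b'),
    tensor f (g + h) = tensor f g + tensor f h
  tensor_smul_left : ∀ {a b a' b' : WObj} (z : ℂ) (f : Hom a b) (h : Hom a' b'),
    tensor (z • f) h = z • tensor f h
  tensor_smul_right : ∀ {a b a' b' : WObj} (z : ℂ) (f : Hom a b) (h : Hom a' b'),
    tensor f (z • h) = z • tensor f h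
  tensor_id : ∀ a b : WObj, tensor (id a) (id b) = id (a ++ b)
  /- super-interchange law for homogeneous morphisms -/
  tensor_interchange : ∀ {a b c a' b' c' : WObj} (f : Hom a b) (g : Hom b c)
      (f' : Hom a' b') (g' : Hom b' c') (p q : ZMod 2),
      f' ∈ par a' b' p → g ∈ par b c q →
      comp (tensor f f') (tensor g g')
        = ((-1 : ℂ) ^ (p * q).val) • tensor (comp f g) (comp f' g')
  rel_tensor_assoc : ∀ {a b a' b' a'' b'' : WObj} (f : Hom a b) (g : Hom a' b')
      (h : Hom a'' b''), HEq (tensor (tensor f g) h) (tensor f (tensor g h))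
  /- parity (supercategory) axioms -/
  par_cover : ∀ a b : WObj, par a b 0 ⊔ par a b 1 = ⊤
  par_indep : ∀ a b : WObj, par a b 0 ⊓ par a b 1 = ⊥
  par_id : ∀ a : WObj, id a ∈ par a a 0
  par_comp : ∀ {a b c : WObj} {p q : ZMod 2} {f : Hom a b} {g : Hom b c},
    f ∈ par a b p → g ∈ par b c q → comp f g ∈ par a c (p + q)
  par_tensor : ∀ {a b a' b' : WObj} {p q : ZMod 2} {f : Hom a b} {g : Hom a' b'},
    f ∈ par a b p → g ∈ par a' b' q → tensor f g ∈ par (a ++ a') (b ++ b') (p + q)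
  par_dot : ∀ k, dot k ∈ par [k] [k] 1
  par_merge : ∀ k l, merge k l ∈ par [k, l] [k + l] 0
  par_split : ∀ k l, split k l ∈ par [k + l] [k, l] 0
  /- defining web relations (Definition 4.1) -/
  rel_merge_assoc : ∀ h k l : ℕ,
    HEq (comp (tensor (merge h k) (id [l])) (merge (h + k) l))
        (comp (tensor (id [h]) (merge k l)) (merge h (k + l)))
  rel_split_assoc : ∀ h k l : ℕ,
    HEq (comp (split (h + k) l) (tensor (split h k) (id [l])))
        (comp (split h (k + l)) (tensor (id [h]) (split k l)))
  rel_digon : ∀ k l : ℕ,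
    comp (split k l) (merge k l) = (((k + l).choose l : ℕ) : ℂ) • id [k + l]
  rel_dot_dot : ∀ k : ℕ, comp (dot k) (dot k) = (k : ℂ) • id [k]
  rel_dots_merge : ∀ k l : ℕ,
    comp (merge k l) (dot (k + l))
      = comp (show Hom [k, l] [k, l] from tensor (dot k) (id [l])) (merge k l)
        + comp (show Hom [k, l] [k, l] from tensor (id [k]) (dot l)) (merge k l)
  rel_dots_split : ∀ k l : ℕ,
    comp (dot (k + l)) (split k l)
      = comp (split k l) (show Hom [k, l] [k, l] from tensor (dot k) (id [l]))
        + comp (split k l) (show Hom [k, l] [k, l] from tensor (id [k]) (dot l))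
  rel_dumbbell :
    comp (merge 1 1) (split 1 1)
      = comp (show Hom [1, 1] [1, 1] from tensor (dot 1) (dot 1))
          (comp (comp (merge 1 1) (split 1 1))
            (show Hom [1, 1] [1, 1] from tensor (dot 1) (dot 1)))
        + (2 : ℂ) • id [1, 1]
  rel_square_switch : ∀ k l : ℕ,
    comp
        (comp (show Hom [k + 1, 1 + l] [k, 1, 1 + l] from tensor (split k 1) (id [1 + l]))
          (show Hom [k, 1, 1 + l] [k, 1 + (1 + l)] from tensor (id [k]) (merge 1 (1 + l))))
        (comp (show Hom [k, 1 + (1 + l)] [k, 1, 1 + l] from tensor (id [k]) (split 1 (1 + l)))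
          (show Hom [k, 1, 1 + l] [k + 1, 1 + l] from tensor (merge k 1) (id [1 + l])))
      - comp
          (comp (show Hom [k + 1, 1 + l] [k + 1, 1, l] from tensor (id [k + 1]) (split 1 l))
            (show Hom [k + 1, 1, l] [k + 2, l] from tensor (merge (k + 1) 1) (id [l])))
          (comp (show Hom [k + 2, l] [k + 1, 1, l] from tensor (split (k + 1) 1) (id [l]))
            (show Hom [k + 1, 1, l] [k + 1, 1 + l] from tensor (id [k + 1]) (merge 1 l)))
      = (((k : ℂ) + 1) - ((l : ℂ) + 1)) • id [k + 1, 1 + l]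

namespace QWebUp

/-- Transport of morphisms along equalities of objects. -/
def rc (W : QWebUp) {a a' b b' : WObj} (ha : a = a') (hb : b = b') (f : W.Hom a b) :
    W.Hom a' b' := ha ▸ hb ▸ f

/-- The object `↑₁^k`. -/
def oneW (k : ℕ) : WObj := List.replicate k 1

theorem oneW_succ (k : ℕ) : oneW (k + 1) = oneW k ++ [1] := List.replicate_add k 1 1

theorem oneW_sum (k : ℕ) : (oneW k).sum = k := by
  induction k with
  | zero => rfl
  | succ k ih => simp only [oneW, List.replicate_succ, List.sum_cons] at *; omega

theorem oneW_split2 {i j k : ℕ} (h : i + 2 + j = k) :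
    (oneW i ++ [1, 1]) ++ oneW j = oneW k := by
  subst h
  show (List.replicate i 1 ++ List.replicate 2 1) ++ List.replicate j 1 = _
  rw [← List.replicate_add, ← List.replicate_add]
  rfl

theorem oneW_split1 {i j k : ℕ} (h : i + 1 + j = k) :
    (oneW i ++ [1]) ++ oneW j = oneW k := by
  subst h
  show (List.replicate i 1 ++ List.replicate 1 1) ++ List.replicate j 1 = _
  rw [← List.replicate_add, ← List.replicate_add]
  rfl

/-- The crossing of two `↑₁` strands: `split ∘ merge − id`. -/
def cross (W : QWebUp) : W.Hom [1, 1] [1, 1] :=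
  W.comp (W.merge 1 1) (W.split 1 1) - W.id [1, 1]

/-- Apply a two-strand endomorphism on strands `i, i+1` of `↑₁^k`. -/
def onPair (W : QWebUp) (k i : ℕ) (g : W.Hom [1, 1] [1, 1]) :
    W.Hom (oneW k) (oneW k) :=
  if h : i + 2 ≤ k then
    W.rc (oneW_split2 (by omega)) (oneW_split2 (by omega))
      (W.tensor (W.tensor (W.id (oneW i)) g) (W.id (oneW (k - i - 2))))
  else 0

/-- Apply a one-strand endomorphism on strand `i` of `↑₁^k`. -/
def onOne (W : QWebUp) (k i : ℕ) (g : W.Hom [1] [1]) :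
    W.Hom (oneW k) (oneW k) :=
  if h : i + 1 ≤ k then
    W.rc (oneW_split1 (by omega)) (oneW_split1 (by omega))
      (W.tensor (W.tensor (W.id (oneW i)) g) (W.id (oneW (k - i - 1))))
  else 0

/-- `s_i`: the crossing of strands `i, i+1` (0-indexed) of `↑₁^k`. -/
def sGen (W : QWebUp) (k i : ℕ) : W.Hom (oneW k) (oneW k) := W.onPair k i W.cross

/-- `c_i`: the dot on strand `i` (0-indexed) of `↑₁^k`. -/
def cGen (W : QWebUp) (k i : ℕ) : W.Hom (oneW k) (oneW k) := W.onOne k i (W.dot 1)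

/-- The iterated merge `merge^{(k+1)} : ↑₁^{k+1} → ↑_{k+1}`. -/
def mergeAll (W : QWebUp) : (k : ℕ) → W.Hom (oneW (k + 1)) [k + 1]
  | 0 => W.id [1]
  | k + 1 =>
    W.comp (W.rc (oneW_succ (k + 1)).symm rfl (W.tensor (mergeAll W k) (W.id [1])))
      (W.merge (k + 1) 1)

/-- The iterated split `split^{(k+1)} : ↑_{k+1} → ↑₁^{k+1}`. -/
def splitAll (W : QWebUp) : (k : ℕ) → W.Hom [k + 1] (oneW (k + 1))
  | 0 => W.id [1]
  | k + 1 =>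
    W.comp (W.split (k + 1) 1)
      (W.rc rfl (oneW_succ (k + 1)).symm (W.tensor (splitAll W k) (W.id [1])))

/-- The clasp idempotent `Cl_{k+1} = (1/(k+1)!) split^{(k+1)} ∘ merge^{(k+1)}`. -/
def clasp (W : QWebUp) (k : ℕ) : W.Hom (oneW (k + 1)) (oneW (k + 1)) :=
  ((Nat.factorial (k + 1) : ℕ) : ℂ)⁻¹ • W.comp (mergeAll W k) (splitAll W k)

end QWebUp

/-- A word in the simple transpositions representing the transposition `(0 i)`. -/
def swapWord : ℕ → List ℕ
  | 0 => []
  | m + 1 => (List.range (m + 1)).reverse ++ (List.range (m + 1)).drop 1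

/-- A canonical word in the (0-indexed) simple transpositions representing a
permutation, via the standard recursive decomposition. -/
def permWord : {n : ℕ} → Equiv.Perm (Fin n) → List ℕ
  | 0, _ => []
  | _ + 1, σ =>
    swapWord ((Equiv.Perm.decomposeFin σ).1 : ℕ)
      ++ (permWord (Equiv.Perm.decomposeFin σ).2).map (· + 1)

namespace QWebUp

/-- Compose a list of endomorphisms (in the order of the list, as an ordinary
product of operators: the head of the list is applied last). -/
def compSeq (W : QWebUp) {a : WObj} (l : List (W.Hom a a)) : W.Hom a a :=
  l.foldr (fun f g => W.comp g f) (W.id a)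

/-- The endomorphism of `↑₁^k` given by a word in the crossings. -/
def ofWordW (W : QWebUp) (k : ℕ) (w : List ℕ) : W.Hom (oneW k) (oneW k) :=
  compSeq W (w.map fun j => sGen W k j)

/-- `ξ_k(σ)`: the permutation web attached to `σ ∈ Σ_k`. -/
def permW (W : QWebUp) (k : ℕ) (σ : Equiv.Perm (Fin k)) : W.Hom (oneW k) (oneW k) :=
  ofWordW W k (permWord σ)

end QWebUp

namespace QWebUp

/-- A leftward rung of thickness `r` on `↑_k ↑_{r+t}` (split off `r` from the
right strand and merge it into the left strand). -/
def rungL (W : QWebUp) (k r t : ℕ) : W.Hom [k, r + t] [k + r, t] :=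
  W.comp (show W.Hom [k, r + t] [k, r, t] from W.tensor (W.id [k]) (W.split r t))
    (show W.Hom [k, r, t] [k + r, t] from W.tensor (W.merge k r) (W.id [t]))

/-- A rightward rung of thickness `r` on `↑_{k+r} ↑_t` (split off `r` from the
left strand and merge it into the right strand). -/
def rungR (W : QWebUp) (r k t : ℕ) : W.Hom [k + r, t] [k, r + t] :=
  W.comp (show W.Hom [k + r, t] [k, r, t] from W.tensor (W.split k r) (W.id [t]))
    (show W.Hom [k, r, t] [k, r + t] from W.tensor (W.id [k]) (W.merge r t))

/-- A leftward rung of thickness `1` with a dot on the rung. -/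
def rungLdot (W : QWebUp) (k t : ℕ) : W.Hom [k, 1 + t] [k + 1, t] :=
  W.comp (show W.Hom [k, 1 + t] [k, 1, t] from W.tensor (W.id [k]) (W.split 1 t))
    (W.comp
      (show W.Hom [k, 1, t] [k, 1, t] from
        W.tensor (W.tensor (W.id [k]) (W.dot 1)) (W.id [t]))
      (show W.Hom [k, 1, t] [k + 1, t] from W.tensor (W.merge k 1) (W.id [t])))

/-- A rightward rung of thickness `1` with a dot on the rung. -/
def rungRdot (W : QWebUp) (k t : ℕ) : W.Hom [k + 1, t] [k, 1 + t] :=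
  W.comp (show W.Hom [k + 1, t] [k, 1, t] from W.tensor (W.split k 1) (W.id [t]))
    (W.comp
      (show W.Hom [k, 1, t] [k, 1, t] from
        W.tensor (W.tensor (W.id [k]) (W.dot 1)) (W.id [t]))
      (show W.Hom [k, 1, t] [k, 1 + t] from W.tensor (W.id [k]) (W.merge 1 t)))

end QWebUp

section RingLemmas

variable {R : Type*} [Ring R]

theorem eq_of_two_mul_eq [IsAddTorsionFree R] {x y : R} (h : 2 * x = 2 * y) : x = y := by
  have h2 : (2 : ℕ) • x = (2 : ℕ) • y := by simpa [two_mul, two_nsmul] using h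
  exact nsmul_right_injective two_ne_zero h2

/-- The relations between the two dots and the dumbbell on a pair of strands of thickness one;
`e` is the identity of the word carrying them. -/
structure DumbbellRel (e c₁ c₂ X : R) : Prop where
  ee : e * e = e
  ec₁ : e * c₁ = c₁
  c₁e : c₁ * e = c₁
  ec₂ : e * c₂ = c₂
  c₂e : c₂ * e = c₂
  eX : e * X = X
  Xe : X * e = X
  sq₁ : c₁ * c₁ = e
  sq₂ : c₂ * c₂ = e
  anti : c₂ * c₁ = -(c₁ * c₂)
  XX : X * X = 2 * X
  comm : (c₁ + c₂) * X = X * (c₁ + c₂)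
  dumb : X = c₁ * c₂ * X * (c₁ * c₂) + 2 * e

namespace DumbbellRel

variable {e c₁ c₂ X : R}

theorem sq (h : DumbbellRel e c₁ c₂ X) : c₁ * c₂ * (c₁ * c₂) = -e := by
  have h1 : c₁ * c₂ * (c₁ * c₂) = c₁ * (c₂ * c₁) * c₂ := by noncomm_ring
  rw [h1, h.anti]
  have h2 : c₁ * -(c₁ * c₂) * c₂ = -(c₁ * c₁ * (c₂ * c₂)) := by noncomm_ring
  rw [h2, h.sq₁, h.sq₂, h.ee]

theorem X_mul_cc (h : DumbbellRel e c₁ c₂ X) :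
    X * (c₁ * c₂) + c₁ * c₂ * X = 2 * (c₁ * c₂) := by
  linear_combination (norm := noncomm_ring) h.dumb * c₁ * c₂ + (c₁ * c₂ * X) * h.sq
    - c₁ * c₂ * h.Xe + 2 * h.ec₁ * c₂

theorem c₁_mul_X [IsAddTorsionFree R] (h : DumbbellRel e c₁ c₂ X) : c₁ * X = X * c₂ + c₁ - c₂ := by
  apply eq_of_two_mul_eq
  have h0 : c₁ * (c₁ + c₂) * X = c₁ * X * (c₁ + c₂) := by
    linear_combination (norm := noncomm_ring) c₁ * h.comm
  have h1 : X + 2 * (c₁ * c₂) - X * (c₁ * c₂) = c₁ * X * (c₁ + c₂) := by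
    linear_combination (norm := noncomm_ring) h0 - h.sq₁ * X - h.eX - h.X_mul_cc
  have h2 : c₁ * X * (c₁ + c₂) * (c₁ + c₂) = 2 * (c₁ * X) := by
    linear_combination (norm := noncomm_ring) c₁ * X * (h.sq₁ + h.sq₂ + h.anti)
      + 2 * c₁ * h.Xe
  have h3 : c₁ * c₂ * (c₁ + c₂) = c₁ - c₂ := by
    linear_combination (norm := noncomm_ring) c₁ * h.anti - h.sq₁ * c₂ - h.ec₂
      + c₁ * h.sq₂ + h.c₁e
  rw [← h2, ← h1]
  linear_combination (norm := noncomm_ring) (2 - X) * h3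

theorem c₂_mul_X [IsAddTorsionFree R] (h : DumbbellRel e c₁ c₂ X) : c₂ * X = X * c₁ + c₂ - c₁ := by
  linear_combination (norm := noncomm_ring) h.comm - h.c₁_mul_X

theorem X_mul_u [IsAddTorsionFree R] (h : DumbbellRel e c₁ c₂ X) :
    X * (c₁ - c₂) = (c₁ - c₂) * (2 * e - X) := by
  linear_combination (norm := noncomm_ring) h.c₁_mul_X - h.c₂_mul_X - 2 * h.c₁e + 2 * h.c₂e

theorem u_mul_u (h : DumbbellRel e c₁ c₂ X) : (c₁ - c₂) * (c₁ - c₂) = 2 * e := by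
  linear_combination (norm := noncomm_ring) h.sq₁ + h.sq₂ - h.anti

theorem X_u_X [IsAddTorsionFree R] (h : DumbbellRel e c₁ c₂ X) : X * (c₁ - c₂) * X = 0 := by
  linear_combination (norm := noncomm_ring) h.X_mul_u * X + 2 * (c₁ - c₂) * h.eX
   - (c₁ - c₂) * h.XX

theorem conj_add_conj [IsAddTorsionFree R] (h : DumbbellRel e c₁ c₂ X) :
    c₁ * X * c₁ + c₂ * X * c₂ = 2 * e := by
  linear_combination (norm := noncomm_ring) h.c₁_mul_X * c₁ + h.c₂_mul_X * c₂ + h.sq₁ + h.sq₂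
    + X * h.anti - h.anti

end DumbbellRel

instance MulOpposite.instIsAddTorsionFree {A : Type*} [AddMonoid A] [IsAddTorsionFree A] :
    IsAddTorsionFree Aᵐᵒᵖ where
  nsmul_right_injective _ hn _ _ h :=
    MulOpposite.unop_injective (nsmul_right_injective hn (congrArg MulOpposite.unop h))

theorem DumbbellRel.op {e c₁ c₂ X : R} (h : DumbbellRel e c₁ c₂ X) :
    DumbbellRel (MulOpposite.op e) (MulOpposite.op c₁) (MulOpposite.op c₂)
      (MulOpposite.op X) := by
  have h2 : MulOpposite.op (2 : R) = 2 := rfl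
  constructor <;> apply MulOpposite.unop_injective <;>
    simp only [MulOpposite.unop_mul, MulOpposite.unop_add, MulOpposite.unop_op,
      MulOpposite.unop_neg, MulOpposite.unop_ofNat]
  · exact h.ee
  · exact h.c₁e
  · exact h.ec₁
  · exact h.c₂e
  · exact h.ec₂
  · exact h.Xe
  · exact h.eX
  · exact h.sq₁
  · exact h.sq₂
  · rw [h.anti, neg_neg]
  · linear_combination (norm := noncomm_ring) h.XX
  · exact h.comm.symm
  · linear_combination (norm := noncomm_ring) h.dumb + c₁ * c₂ * X * h.anti
      - h.anti * X * c₂ * c₁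

/-- `M` merges a strand of thickness zero, carrying the dot `d`, into the first of two strands of
thickness one; `f`, `b₁`, `b₂`, `Y` are the data of those two strands before the merge. -/
structure ZeroMerge (e c₁ c₂ X f b₁ b₂ Y d M : R) : Prop where
  tgt : DumbbellRel e c₁ c₂ X
  src : DumbbellRel f b₁ b₂ Y
  dd : d * d = 0
  b₂d : b₂ * d = -(d * b₂)
  b₁d : b₁ * d = -(d * b₁)
  Yd : Y * d = d * Y
  fd : f * d = d
  df : d * f = d
  fM : f * M = M
  Me : M * e = M
  Mc₁ : M * c₁ = (d + b₁) * M
  Mc₂ : M * c₂ = b₂ * M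
  YMX : Y * M * X = 2 * (M * X)

/-- The mirror image of `ZeroMerge` for splitting off a strand of thickness zero. -/
structure ZeroSplit (e c₁ c₂ X f b₁ b₂ Y d S : R) : Prop where
  eS : e * S = S
  Sf : S * f = S
  c₁S : c₁ * S = S * (d + b₁)
  c₂S : c₂ * S = S * b₂
  XSY : X * S * Y = 2 * (X * S)

section ZeroStrand

variable {e c₁ c₂ X f b₁ b₂ Y d M S : R}

theorem ZeroMerge.two_mul_YM_aux [IsAddTorsionFree R] (h : ZeroMerge e c₁ c₂ X f b₁ b₂ Y d M) :
    2 * (Y * M) = 2 * (M * X) - d * Y * M * (c₁ * X - 2 * c₁) := by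
  have t := h.tgt
  have s := h.src
  have h1 : Y * (b₁ * b₂) * M * X = 0 := by
    apply eq_of_two_mul_eq
    have : Y * (b₁ * b₂) * Y = 0 := by
      linear_combination (norm := noncomm_ring) s.X_mul_cc * Y - b₁ * b₂ * s.XX
    linear_combination (norm := noncomm_ring) this * M * X - Y * b₁ * b₂ * h.YMX
  have h2 : c₂ * X * (c₁ * c₂) = c₁ * X - 2 * c₁ := by
    linear_combination (norm := noncomm_ring) t.c₂_mul_X * c₁ * c₂ + X * t.sq₁ * c₂
      + X * t.ec₂ + t.anti * c₂ - c₁ * t.sq₂ - t.c₁e - t.sq₁ * c₂ - t.ec₂ - t.c₁_mul_X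
  have h3 : Y * M * (c₁ * c₂) = Y * (d + b₁) * b₂ * M := by
    linear_combination (norm := noncomm_ring) Y * h.Mc₁ * c₂ + Y * (d + b₁) * h.Mc₂
  linear_combination (norm := noncomm_ring) h.YMX - Y * M * t.dumb - 2 * Y * h.Me
    - h3 * X * c₁ * c₂ - h1 * c₁ * c₂ - h.Yd * b₂ * M * X * c₁ * c₂
    + d * Y * h.Mc₂ * X * c₁ * c₂ - d * Y * M * h2

theorem ZeroMerge.d_mul_YM [IsAddTorsionFree R] (h : ZeroMerge e c₁ c₂ X f b₁ b₂ Y d M) :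
    d * Y * M = d * M * X := by
  apply eq_of_two_mul_eq
  linear_combination (norm := noncomm_ring) d * h.two_mul_YM_aux
    - h.dd * Y * M * (c₁ * X - 2 * c₁)

theorem ZeroMerge.two_mul_YM [IsAddTorsionFree R] (h : ZeroMerge e c₁ c₂ X f b₁ b₂ Y d M) :
    2 * (Y * M) = 2 * (M * X) + d * M * X * (c₁ - c₂) := by
  linear_combination (norm := noncomm_ring) h.two_mul_YM_aux
    - h.d_mul_YM * (c₁ * X - 2 * c₁) - d * M * X * h.tgt.c₁_mul_X - d * M * h.tgt.XX * c₂

theorem ZeroSplit.op {e c₁ c₂ X f b₁ b₂ Y d M S : R}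
    (h : ZeroMerge e c₁ c₂ X f b₁ b₂ Y d M) (hS : ZeroSplit e c₁ c₂ X f b₁ b₂ Y d S) :
    ZeroMerge (MulOpposite.op e) (MulOpposite.op c₁) (MulOpposite.op c₂)
      (MulOpposite.op X) (MulOpposite.op f) (MulOpposite.op b₁) (MulOpposite.op b₂)
      (MulOpposite.op Y) (MulOpposite.op d) (MulOpposite.op S) := by
  refine ⟨h.tgt.op, h.src.op, ?_, ?_, ?_, ?_, ?_, ?_, ?_, ?_, ?_, ?_, ?_⟩ <;>
    apply MulOpposite.unop_injective <;>
    simp only [MulOpposite.unop_mul, MulOpposite.unop_add, MulOpposite.unop_op,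
      MulOpposite.unop_neg, MulOpposite.unop_ofNat]
  · exact h.dd
  · rw [h.b₂d, neg_neg]
  · rw [h.b₁d, neg_neg]
  · exact h.Yd.symm
  · exact h.df
  · exact h.fd
  · exact hS.Sf
  · exact hS.eS
  · exact hS.c₁S
  · exact hS.c₂S
  · linear_combination (norm := noncomm_ring) hS.XSY

theorem ZeroSplit.S_mul_Yd [IsAddTorsionFree R] (h : ZeroMerge e c₁ c₂ X f b₁ b₂ Y d M)
    (hS : ZeroSplit e c₁ c₂ X f b₁ b₂ Y d S) : S * Y * d = X * S * d := by
  have := congrArg MulOpposite.unop (hS.op h).d_mul_YM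
  simpa only [MulOpposite.unop_mul, MulOpposite.unop_op, mul_assoc] using this

theorem ZeroSplit.two_mul_SY [IsAddTorsionFree R] (h : ZeroMerge e c₁ c₂ X f b₁ b₂ Y d M)
    (hS : ZeroSplit e c₁ c₂ X f b₁ b₂ Y d S) :
    2 * (S * Y) = 2 * (X * S) + (c₁ - c₂) * X * S * d := by
  have := congrArg MulOpposite.unop (hS.op h).two_mul_YM
  simp only [MulOpposite.unop_mul, MulOpposite.unop_op, MulOpposite.unop_add,
    MulOpposite.unop_sub, MulOpposite.unop_ofNat] at this
  linear_combination (norm := noncomm_ring) this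

theorem ZeroSplit.S_d_M_eq_zero [IsAddTorsionFree R] (h : ZeroMerge e c₁ c₂ X f b₁ b₂ Y d M)
    (hS : ZeroSplit e c₁ c₂ X f b₁ b₂ Y d S) (hSM : S * M = e) : S * d * M = 0 := by
  have t := h.tgt
  have hc₁ : c₁ * (S * d * M) = -(S * d * M * c₁) := by
    linear_combination (norm := noncomm_ring) hS.c₁S * d * M + S * h.b₁d * M
      + S * d * h.Mc₁ + 2 * S * h.dd * M
  have hc₂ : c₂ * (S * d * M) = -(S * d * M * c₂) := by
    linear_combination (norm := noncomm_ring) hS.c₂S * d * M + S * h.b₂d * M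
      + S * d * h.Mc₂
  have he : e * (S * d * M) = S * d * M := by
    linear_combination (norm := noncomm_ring) hS.eS * d * M
  have hX : S * d * M * X = X * (S * d * M) := by
    linear_combination (norm := noncomm_ring) hS.S_mul_Yd h * M - S * h.d_mul_YM - S * h.Yd * M
  have hu : S * d * M * X * (c₁ - c₂) = (c₁ - c₂) * X * (S * d * M) := by
    linear_combination (norm := noncomm_ring) hS.two_mul_SY h * M - S * h.two_mul_YM
      + 2 * X * hSM + 2 * t.Xe - 2 * hSM * X - 2 * t.eX
  have h1 : X * (S * d * M) * (c₁ - c₂) = 0 := by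
    apply eq_of_two_mul_eq
    linear_combination (norm := noncomm_ring) X * hu + t.X_u_X * (S * d * M)
      - X * hX * (c₁ - c₂) - t.XX * (S * d * M) * (c₁ - c₂)
  have h2 : X * (S * d * M) = 0 := by
    apply eq_of_two_mul_eq
    linear_combination (norm := noncomm_ring) h1 * (c₁ - c₂) - X * S * d * M * t.u_mul_u
      - 2 * X * S * d * h.Me
  have hcc : c₁ * c₂ * (S * d * M) = S * d * M * (c₁ * c₂) := by
    linear_combination (norm := noncomm_ring) c₁ * hc₂ - hc₁ * c₂
  have h3 : c₁ * c₂ * (S * d * M) = 0 := by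
    apply eq_of_two_mul_eq
    linear_combination (norm := noncomm_ring) -t.X_mul_cc * (S * d * M) + X * hcc
      + h2 * c₁ * c₂ + c₁ * c₂ * h2
  linear_combination (norm := noncomm_ring) t.sq * (S * d * M) - he - c₁ * c₂ * h3

theorem ZeroSplit.two_sub_mul [IsAddTorsionFree R] (h : ZeroMerge e c₁ c₂ X f b₁ b₂ Y d M)
    (hS : ZeroSplit e c₁ c₂ X f b₁ b₂ Y d S) {V : R} (hV : Y * V = 2 * V) :
    (2 - X) * (S * V * M) = (c₁ - c₂) * (S * d * V * M) := by
  apply eq_of_two_mul_eq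
  linear_combination (norm := noncomm_ring) hS.two_mul_SY h * V * M - 2 * S * hV * M
    - (c₁ - c₂) * hS.S_mul_Yd h * V * M + (c₁ - c₂) * S * h.Yd * V * M
    + (c₁ - c₂) * S * d * hV * M

theorem ZeroMerge.S_d_V_M_X [IsAddTorsionFree R] (h : ZeroMerge e c₁ c₂ X f b₁ b₂ Y d M) {V : R}
    (hV : V * Y = 2 * V) (hd : V * d = d * V) :
    S * d * V * M * X = 2 * (S * d * V * M) := by
  linear_combination (norm := noncomm_ring) -S * hd * M * X - S * V * h.d_mul_YM
    + S * hd * Y * M + S * d * hV * M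

end ZeroStrand

/-- The two ways `L`, `R` of absorbing a strand of thickness zero, carrying the dot `d`, that
stands between two strands of thickness one. -/
structure ZeroBetween (e c₁ c₂ X b₁ b₃ d L M : R) : Prop where
  tgt : DumbbellRel e c₁ c₂ X
  dd : d * d = 0
  b₁d : b₁ * d = -(d * b₁)
  Le : L * e = L
  Me : M * e = M
  LX : L * X = M * X
  Lc₁ : L * c₁ = (b₁ + d) * L
  Lc₂ : L * c₂ = b₃ * L
  Rc₁ : M * c₁ = b₁ * M
  Rc₂ : M * c₂ = (d + b₃) * M

namespace ZeroBetween

variable {e c₁ c₂ X b₁ b₃ d L M : R}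

theorem two_mul_sub (h : ZeroBetween e c₁ c₂ X b₁ b₃ d L M) :
    2 * (L - M) = d * L * X * (c₁ - c₂) := by
  have t := h.tgt
  have h1 : (L - M) * (c₁ * c₂) * X = d * L * X * (c₁ + c₂) := by
    have h2 : L * (c₁ * c₂) = (b₁ + d) * b₃ * L := by
      linear_combination (norm := noncomm_ring) h.Lc₁ * c₂ + (b₁ + d) * h.Lc₂
    have h3 : M * (c₁ * c₂) = b₁ * (d + b₃) * M := by
      linear_combination (norm := noncomm_ring) h.Rc₁ * c₂ + b₁ * h.Rc₂
    linear_combination (norm := noncomm_ring) h2 * X - h3 * X + b₁ * (d + b₃) * h.LX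
      - h.b₁d * L * X - d * h.Lc₂ * X - d * h.Lc₁ * X - h.dd * L * X + d * L * t.comm
  have h4 : (c₁ + c₂) * (c₁ * c₂) = c₂ - c₁ := by
    linear_combination (norm := noncomm_ring) t.sq₁ * c₂ + t.ec₂ + t.anti * c₂ - c₁ * t.sq₂ - t.c₁e
  linear_combination (norm := noncomm_ring) -h1 * c₁ * c₂ - (L - M) * t.dumb + h.LX
    - 2 * h.Le + 2 * h.Me - d * L * X * h4

theorem d_mul_eq [IsAddTorsionFree R] (h : ZeroBetween e c₁ c₂ X b₁ b₃ d L M) : d * L = d * M := by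
  apply eq_of_two_mul_eq
  linear_combination (norm := noncomm_ring) d * h.two_mul_sub + h.dd * L * X * (c₁ - c₂)

theorem sandwich [IsAddTorsionFree R] (h : ZeroBetween e c₁ c₂ X b₁ b₃ d L M) {S N N' : R}
    (hSM : S * M = e) (hSdM : S * d * M = 0) (hN : N' * L = L * N) (hd : N' * d = d * N')
    (heN : e * N = N) :
    S * N' * M = N := by
  apply eq_of_two_mul_eq
  have hSdL : S * d * L = 0 := by
    linear_combination (norm := noncomm_ring) S * h.d_mul_eq + hSdM
  linear_combination (norm := noncomm_ring) -S * N' * h.two_mul_sub + 2 * S * hN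
    + S * h.two_mul_sub * N + 2 * hSM * N + 2 * heN + hSdL * X * (c₁ - c₂) * N
    - S * hd * L * X * (c₁ - c₂) - S * d * hN * X * (c₁ - c₂)
    - hSdL * N * X * (c₁ - c₂)

end ZeroBetween

/-- `X` and `Z` are the dumbbells on the first two and the last two of three strands of thickness
one. -/
theorem DumbbellRel.braid_defect_eq_zero [IsAddTorsionFree R] {e c₁ c₂ c₃ X Z : R}
    (h : DumbbellRel e c₁ c₂ X)
    (k : DumbbellRel e c₂ c₃ Z) (hX : c₃ * X = X * c₃) (hZ : c₁ * Z = Z * c₁)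
    (hx : (2 - X) * (Z * X * Z - Z) * X = 2 * ((2 - X) * (Z * X * Z - Z))) :
    (2 - X) * (Z * X * Z - Z) = 0 := by
  obtain ⟨a, rfl⟩ : ∃ a, X = a + e := ⟨X - e, by abel⟩
  obtain ⟨b, rfl⟩ : ∃ b, Z = b + e := ⟨Z - e, by abel⟩
  have ee := h.ee
  have ea : e * a = a := by linear_combination (norm := noncomm_ring) h.eX - ee
  have ae : a * e = a := by linear_combination (norm := noncomm_ring) h.Xe - ee
  have eb : e * b = b := by linear_combination (norm := noncomm_ring) k.eX - ee
  have be : b * e = b := by linear_combination (norm := noncomm_ring) k.Xe - ee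
  have aa : a * a = e := by linear_combination (norm := noncomm_ring) h.XX - ea - ae - ee
  have bb : b * b = e := by linear_combination (norm := noncomm_ring) k.XX - eb - be - ee
  have h₁ : c₁ * a = a * c₂ := by
    linear_combination (norm := noncomm_ring) h.c₁_mul_X - h.c₁e + h.ec₂
  have h₂ : c₂ * a = a * c₁ := by
    linear_combination (norm := noncomm_ring) h.c₂_mul_X - h.c₂e + h.ec₁
  have h₃ : c₃ * a = a * c₃ := by
    linear_combination (norm := noncomm_ring) hX - k.c₂e + k.ec₂
  have k₁ : c₁ * b = b * c₁ := by
    linear_combination (norm := noncomm_ring) hZ - h.c₁e + h.ec₁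
  have k₂ : c₂ * b = b * c₃ := by
    linear_combination (norm := noncomm_ring) k.c₁_mul_X - k.c₁e + k.ec₂
  have k₃ : c₃ * b = b * c₂ := by
    linear_combination (norm := noncomm_ring) k.c₂_mul_X - k.c₂e + k.ec₁
  have hq : (2 - (a + e)) * ((b + e) * (a + e) * (b + e) - (b + e))
      = b * a * b + b * a - a * b * a - a * b * a * b := by
    have h4 : (b + e) * (a + e) * (b + e) - (b + e) = b * a * b + b * a + a * b + a + b + e := by
      linear_combination (norm := noncomm_ring) b * ae + ea * b + ea * e + ae + be * b
        + be * e + bb + ee * b + eb + ee * e + be + ee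
    rw [h4]
    linear_combination (norm := noncomm_ring) -aa * b - aa - ae - eb * a * b - eb * a
      - ea * b - ea - 2 * eb - ee
  rw [hq] at hx ⊢
  set x := b * a * b + b * a - a * b * a - a * b * a * b with hxdef
  have xe : x * e = x := by
    linear_combination (norm := noncomm_ring) hxdef * (e - 1) + b * a * be + b * ae - a * b * ae
      - a * b * a * be
  have xa : x * a = x := by linear_combination (norm := noncomm_ring) hx - xe
  have hc : c₃ * x = x * c₁ := by
    rw [hxdef]
    linear_combination (norm := noncomm_ring) k₃ * a * b + b * h₂ * b + b * a * k₁
      + k₃ * a + b * h₂ - h₃ * b * a - a * k₃ * a - a * b * h₂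
      - h₃ * b * a * b - a * k₃ * a * b - a * b * h₂ * b - a * b * a * k₁
  have hc₂ : x * c₁ = x * c₂ := by
    linear_combination (norm := noncomm_ring) hc * a - c₃ * xa - hc + x * h₁ + xa * c₂
  apply eq_of_two_mul_eq
  linear_combination (norm := noncomm_ring) hc₂ * c₁ - hc₂ * c₂ + x * h.anti - x * h.sq₁
    - x * h.sq₂ - 2 * xe

end RingLemmas

/-- The generating webs. -/
inductive WGen
  | merge (k l : ℕ)
  | split (k l : ℕ)
  | dot (k : ℕ)

namespace WGen

def src : WGen → List ℕ
  | merge k l => [k, l]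
  | split k l => [k + l]
  | dot k => [k]

def tgt : WGen → List ℕ
  | merge k l => [k + l]
  | split k l => [k, l]
  | dot k => [k]

/-- The sign of the super-interchange of two generators. -/
def sgn : WGen → WGen → ℤ
  | dot _, dot _ => -1
  | _, _ => 1

/-- Rotation by a half turn. -/
def rot : WGen → WGen
  | merge k l => split l k
  | split k l => merge l k
  | dot k => dot k

end WGen

open WGen in
/-- A ring containing all webs: `gen la g rb` is the generator `g` with the identity strands `la`
(listed from right to left) on its left and `rb` on its right, `one w` is the identity of the
word `w`, and a product is the composite read from left to right. -/
structure WebCalc (R : Type*) [Ring R] where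
  one : List ℕ → R
  gen : List ℕ → WGen → List ℕ → R
  one_mul_one : ∀ w, one w * one w = one w
  one_mul_gen : ∀ la g rb, one (la.reverseAux (g.src ++ rb)) * gen la g rb = gen la g rb
  gen_mul_one : ∀ la g rb, gen la g rb * one (la.reverseAux (g.tgt ++ rb)) = gen la g rb
  exchange : ∀ la g mid h rb,
    gen la g (mid ++ (h.src ++ rb)) * gen ((g.tgt ++ mid).reverseAux la) h rb
      = g.sgn h • (gen ((g.src ++ mid).reverseAux la) h rb * gen la g (mid ++ (h.tgt ++ rb)))
  merge_assoc : ∀ la h k l rb,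
    gen la (merge h k) (l :: rb) * gen la (merge (h + k) l) rb
      = gen (h :: la) (merge k l) rb * gen la (merge h (k + l)) rb
  split_assoc : ∀ la h k l rb,
    gen la (split (h + k) l) rb * gen la (split h k) (l :: rb)
      = gen la (split h (k + l)) rb * gen (h :: la) (split k l) rb
  digon : ∀ la k l rb,
    gen la (split k l) rb * gen la (merge k l) rb
      = (k + l).choose l • one (la.reverseAux ((k + l) :: rb))
  dot_dot : ∀ la k rb,
    gen la (dot k) rb * gen la (dot k) rb = k • one (la.reverseAux (k :: rb))
  merge_dot : ∀ la k l rb,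
    gen la (merge k l) rb * gen la (dot (k + l)) rb
      = (gen la (dot k) (l :: rb) + gen (k :: la) (dot l) rb) * gen la (merge k l) rb
  dot_split : ∀ la k l rb,
    gen la (dot (k + l)) rb * gen la (split k l) rb
      = gen la (split k l) rb * (gen la (dot k) (l :: rb) + gen (k :: la) (dot l) rb)
  dumbbell : ∀ la rb,
    gen la (merge 1 1) rb * gen la (split 1 1) rb
      = gen la (dot 1) (1 :: rb) * gen (1 :: la) (dot 1) rb
          * (gen la (merge 1 1) rb * gen la (split 1 1) rb)
          * (gen la (dot 1) (1 :: rb) * gen (1 :: la) (dot 1) rb)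
        + 2 * one (la.reverseAux (1 :: 1 :: rb))
  square_switch : ∀ la k l rb,
    gen la (split k 1) ((1 + l) :: rb)
        * (gen (k :: la) (merge 1 (1 + l)) rb * gen (k :: la) (split 1 (1 + l)) rb)
        * gen la (merge k 1) ((1 + l) :: rb)
      + l • one (la.reverseAux ((k + 1) :: (1 + l) :: rb))
    = gen ((k + 1) :: la) (split 1 l) rb
        * (gen la (merge (k + 1) 1) (l :: rb) * gen la (split (k + 1) 1) (l :: rb))
        * gen ((k + 1) :: la) (merge 1 l) rb
      + k • one (la.reverseAux ((k + 1) :: (1 + l) :: rb))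

namespace WebCalc

section Relations

variable {R : Type*} [Ring R] (C : WebCalc R)

/-- A merge between identity strands. -/
abbrev m (la : List ℕ) (k l : ℕ) (rb : List ℕ) : R := C.gen la (.merge k l) rb

/-- A split between identity strands. -/
abbrev s (la : List ℕ) (k l : ℕ) (rb : List ℕ) : R := C.gen la (.split k l) rb

/-- A dot between identity strands. -/
abbrev d (la : List ℕ) (k : ℕ) (rb : List ℕ) : R := C.gen la (.dot k) rb

/-- A merge followed by the split of the same type, between identity strands. -/
def N (la : List ℕ) (k l : ℕ) (rb : List ℕ) : R := C.m la k l rb * C.s la k l rb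

/-- The identity of a word cut into a reversed left part and a right part. -/
abbrev o (la rb : List ℕ) : R := C.one (la.reverseAux rb)

theorem gen_comm (la : List ℕ) (g : WGen) (mid : List ℕ) (h : WGen) (rb : List ℕ)
    (hs : g.sgn h = 1 := by rfl) :
    C.gen la g (mid ++ (h.src ++ rb)) * C.gen ((g.tgt ++ mid).reverseAux la) h rb
      = C.gen ((g.src ++ mid).reverseAux la) h rb * C.gen la g (mid ++ (h.tgt ++ rb)) := by
  rw [C.exchange, hs, one_smul]

theorem dot_anticomm (la : List ℕ) (k : ℕ) (mid : List ℕ) (l : ℕ) (rb : List ℕ) :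
    C.d (mid.reverseAux (k :: la)) l rb * C.d la k (mid ++ l :: rb)
      = -(C.d la k (mid ++ l :: rb) * C.d (mid.reverseAux (k :: la)) l rb) :=
  (neg_eq_iff_eq_neg.2 ((C.exchange la (.dot k) mid (.dot l) rb).trans (neg_one_smul ℤ _))).symm

theorem N_comm_left (la : List ℕ) (g : WGen) (mid : List ℕ) (k l : ℕ) (rb : List ℕ) :
    C.gen la g (mid ++ k :: l :: rb) * C.N ((g.tgt ++ mid).reverseAux la) k l rb
      = C.N ((g.src ++ mid).reverseAux la) k l rb * C.gen la g (mid ++ k :: l :: rb) := by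
  have h₁ : C.gen la g (mid ++ k :: l :: rb) * C.m ((g.tgt ++ mid).reverseAux la) k l rb
      = C.m ((g.src ++ mid).reverseAux la) k l rb * C.gen la g (mid ++ (k + l) :: rb) :=
    C.gen_comm la g mid (.merge k l) rb (by cases g <;> rfl)
  have h₂ : C.gen la g (mid ++ (k + l) :: rb) * C.s ((g.tgt ++ mid).reverseAux la) k l rb
      = C.s ((g.src ++ mid).reverseAux la) k l rb * C.gen la g (mid ++ k :: l :: rb) :=
    C.gen_comm la g mid (.split k l) rb (by cases g <;> rfl)
  rw [N, N, ← mul_assoc, h₁, mul_assoc, h₂, mul_assoc]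

theorem N_comm_right (la : List ℕ) (k l : ℕ) (mid : List ℕ) (h : WGen) (rb : List ℕ) :
    C.N la k l (mid ++ (h.src ++ rb)) * C.gen (mid.reverseAux (l :: k :: la)) h rb
      = C.gen (mid.reverseAux (l :: k :: la)) h rb * C.N la k l (mid ++ (h.tgt ++ rb)) := by
  have h₁ : C.m la k l (mid ++ (h.src ++ rb)) * C.gen (mid.reverseAux ((k + l) :: la)) h rb
      = C.gen (mid.reverseAux (l :: k :: la)) h rb * C.m la k l (mid ++ (h.tgt ++ rb)) :=
    C.gen_comm la (.merge k l) mid h rb (by cases h <;> rfl)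
  have h₂ : C.s la k l (mid ++ (h.src ++ rb)) * C.gen (mid.reverseAux (l :: k :: la)) h rb
      = C.gen (mid.reverseAux ((k + l) :: la)) h rb * C.s la k l (mid ++ (h.tgt ++ rb)) :=
    C.gen_comm la (.split k l) mid h rb (by cases h <;> rfl)
  rw [N, N, mul_assoc, h₂, ← mul_assoc, ← mul_assoc, h₁]

theorem one_mul_N (la : List ℕ) (k l : ℕ) (rb : List ℕ) :
    C.o la (k :: l :: rb) * C.N la k l rb = C.N la k l rb := by
  rw [N, ← mul_assoc]
  exact congrArg (· * _) (C.one_mul_gen la (.merge k l) rb)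

theorem N_mul_one (la : List ℕ) (k l : ℕ) (rb : List ℕ) :
    C.N la k l rb * C.o la (k :: l :: rb) = C.N la k l rb := by
  rw [N, mul_assoc]
  exact congrArg (_ * ·) (C.gen_mul_one la (.split k l) rb)

theorem N_mul_N (la : List ℕ) (k l : ℕ) (rb : List ℕ) :
    C.N la k l rb * C.N la k l rb = (k + l).choose l • C.N la k l rb := by
  have h := C.digon la k l rb
  have h₂ : C.o la ((k + l) :: rb) * C.s la k l rb = _ := C.one_mul_gen la (.split k l) rb
  rw [N]
  linear_combination (norm := noncomm_ring) C.m la k l rb * h * C.s la k l rb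
    + (k + l).choose l • C.m la k l rb * h₂

theorem dumbbellRel (la rb : List ℕ) :
    DumbbellRel (C.o la (1 :: 1 :: rb)) (C.d la 1 (1 :: rb)) (C.d (1 :: la) 1 rb)
      (C.N la 1 1 rb) where
  ee := C.one_mul_one _
  ec₁ := C.one_mul_gen la (.dot 1) (1 :: rb)
  c₁e := C.gen_mul_one la (.dot 1) (1 :: rb)
  ec₂ := C.one_mul_gen (1 :: la) (.dot 1) rb
  c₂e := C.gen_mul_one (1 :: la) (.dot 1) rb
  eX := C.one_mul_N la 1 1 rb
  Xe := C.N_mul_one la 1 1 rb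
  sq₁ := (C.dot_dot la 1 (1 :: rb)).trans (one_smul ℕ _)
  sq₂ := (C.dot_dot (1 :: la) 1 rb).trans (one_smul ℕ _)
  anti := C.dot_anticomm la 1 [] 1 rb
  XX := by rw [N_mul_N, two_mul]; exact two_nsmul _
  comm := by
    have h₁ := C.merge_dot la 1 1 rb
    have h₂ := C.dot_split la 1 1 rb
    rw [N]
    linear_combination (norm := noncomm_ring) C.m la 1 1 rb * h₂ - h₁ * C.s la 1 1 rb
  dumb := C.dumbbell la rb

theorem N_mul_m (la : List ℕ) (k l : ℕ) (rb : List ℕ) :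
    C.N la k l rb * C.m la k l rb = (k + l).choose l • C.m la k l rb := by
  have h : C.m la k l rb * C.o la ((k + l) :: rb) = _ := C.gen_mul_one la (.merge k l) rb
  rw [N, mul_assoc, C.digon, mul_smul_comm, h]

theorem s_mul_N (la : List ℕ) (k l : ℕ) (rb : List ℕ) :
    C.s la k l rb * C.N la k l rb = (k + l).choose l • C.s la k l rb := by
  have h : C.o la ((k + l) :: rb) * C.s la k l rb = _ := C.one_mul_gen la (.split k l) rb
  rw [N, ← mul_assoc, C.digon, smul_mul_assoc, h]

theorem N_right_mul_mm (la : List ℕ) (h k l : ℕ) (rb : List ℕ) :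
    C.N (h :: la) k l rb * (C.m la h k (l :: rb) * C.m la (h + k) l rb)
      = (k + l).choose l • (C.m la h k (l :: rb) * C.m la (h + k) l rb) := by
  rw [C.merge_assoc, ← mul_assoc, N_mul_m, smul_mul_assoc]

theorem N_left_mul_mm (la : List ℕ) (h k l : ℕ) (rb : List ℕ) :
    C.N la h k (l :: rb) * (C.m (h :: la) k l rb * C.m la h (k + l) rb)
      = (h + k).choose k • (C.m (h :: la) k l rb * C.m la h (k + l) rb) := by
  rw [← C.merge_assoc, ← mul_assoc, N_mul_m, smul_mul_assoc]

theorem ss_mul_N_right (la : List ℕ) (h k l : ℕ) (rb : List ℕ) :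
    C.s la (h + k) l rb * C.s la h k (l :: rb) * C.N (h :: la) k l rb
      = (k + l).choose l • (C.s la (h + k) l rb * C.s la h k (l :: rb)) := by
  rw [C.split_assoc, mul_assoc, s_mul_N, mul_smul_comm]

theorem ss_mul_N_left (la : List ℕ) (h k l : ℕ) (rb : List ℕ) :
    C.s la h (k + l) rb * C.s (h :: la) k l rb * C.N la h k (l :: rb)
      = (h + k).choose k • (C.s la h (k + l) rb * C.s (h :: la) k l rb) := by
  rw [← C.split_assoc, mul_assoc, s_mul_N, mul_smul_comm]

theorem s_mul_m_zero (la : List ℕ) (l : ℕ) (rb : List ℕ) :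
    C.s la 0 l rb * C.m la 0 l rb = C.o la (l :: rb) := by
  rw [C.digon, zero_add, Nat.choose_self, one_smul]

theorem s_mul_m_one (la : List ℕ) (l : ℕ) (rb : List ℕ) :
    C.s la 1 l rb * C.m la 1 l rb = (l + 1) • C.o la ((1 + l) :: rb) := by
  rw [C.digon, Nat.add_comm 1 l, Nat.choose_succ_self_right]

theorem zeroMerge (la rb : List ℕ) :
    ZeroMerge (C.o la (1 :: 1 :: rb)) (C.d la 1 (1 :: rb)) (C.d (1 :: la) 1 rb) (C.N la 1 1 rb)
      (C.o la (0 :: 1 :: 1 :: rb)) (C.d (0 :: la) 1 (1 :: rb)) (C.d (1 :: 0 :: la) 1 rb)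
      (C.N (0 :: la) 1 1 rb) (C.d la 0 (1 :: 1 :: rb)) (C.m la 0 1 (1 :: rb)) where
  tgt := C.dumbbellRel la rb
  src := C.dumbbellRel (0 :: la) rb
  dd := (C.dot_dot la 0 (1 :: 1 :: rb)).trans (zero_smul ℕ _)
  b₂d := C.dot_anticomm la 0 [1] 1 rb
  b₁d := C.dot_anticomm la 0 [] 1 (1 :: rb)
  Yd := (C.N_comm_left la (.dot 0) [] 1 1 rb).symm
  fd := C.one_mul_gen la (.dot 0) (1 :: 1 :: rb)
  df := C.gen_mul_one la (.dot 0) (1 :: 1 :: rb)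
  fM := C.one_mul_gen la (.merge 0 1) (1 :: rb)
  Me := C.gen_mul_one la (.merge 0 1) (1 :: rb)
  Mc₁ := C.merge_dot la 0 1 (1 :: rb)
  Mc₂ := C.gen_comm la (.merge 0 1) [] (.dot 1) rb
  YMX := by
    have h : C.N (0 :: la) 1 1 rb * (C.m la 0 1 (1 :: rb) * C.m la 1 1 rb)
        = 2 • (C.m la 0 1 (1 :: rb) * C.m la 1 1 rb) := C.N_right_mul_mm la 0 1 1 rb
    have hN : C.N la 1 1 rb = C.m la 1 1 rb * C.s la 1 1 rb := rfl
    rw [hN]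
    linear_combination (norm := noncomm_ring) h * C.s la 1 1 rb

theorem zeroSplit (la rb : List ℕ) :
    ZeroSplit (C.o la (1 :: 1 :: rb)) (C.d la 1 (1 :: rb)) (C.d (1 :: la) 1 rb) (C.N la 1 1 rb)
      (C.o la (0 :: 1 :: 1 :: rb)) (C.d (0 :: la) 1 (1 :: rb)) (C.d (1 :: 0 :: la) 1 rb)
      (C.N (0 :: la) 1 1 rb) (C.d la 0 (1 :: 1 :: rb)) (C.s la 0 1 (1 :: rb)) where
  eS := C.one_mul_gen la (.split 0 1) (1 :: rb)
  Sf := C.gen_mul_one la (.split 0 1) (1 :: rb)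
  c₁S := C.dot_split la 0 1 (1 :: rb)
  c₂S := (C.gen_comm la (.split 0 1) [] (.dot 1) rb).symm
  XSY := by
    have h : C.s la 1 1 rb * C.s la 0 1 (1 :: rb) * C.N (0 :: la) 1 1 rb
        = 2 • (C.s la 1 1 rb * C.s la 0 1 (1 :: rb)) := C.ss_mul_N_right la 0 1 1 rb
    have hN : C.N la 1 1 rb = C.m la 1 1 rb * C.s la 1 1 rb := rfl
    rw [hN]
    linear_combination (norm := noncomm_ring) C.m la 1 1 rb * h

theorem zero_dot_bubble_eq_zero [IsAddTorsionFree R] (la : List ℕ) (l : ℕ) (rb : List ℕ) :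
    C.s la 0 1 ((1 + l) :: rb) * C.d la 0 (1 :: (1 + l) :: rb)
      * C.m la 0 1 ((1 + l) :: rb) = 0 := by
  have h := (C.zeroSplit la (l :: rb)).S_d_M_eq_zero (C.zeroMerge la (l :: rb))
    (C.s_mul_m_zero la 1 (1 :: l :: rb))
  have hU := C.s_mul_m_one (1 :: la) l rb
  have h₁ : C.s la 0 1 ((1 + l) :: rb) * C.s (1 :: 0 :: la) 1 l rb
      = C.s (1 :: la) 1 l rb * C.s la 0 1 (1 :: l :: rb) :=
    C.gen_comm la (.split 0 1) [] (.split 1 l) rb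
  have h₂ : C.d la 0 (1 :: (1 + l) :: rb) * C.s (1 :: 0 :: la) 1 l rb
      = C.s (1 :: 0 :: la) 1 l rb * C.d la 0 (1 :: 1 :: l :: rb) :=
    C.gen_comm la (.dot 0) [1] (.split 1 l) rb
  have h₃ : C.m la 0 1 ((1 + l) :: rb) * C.s (1 :: la) 1 l rb
      = C.s (1 :: 0 :: la) 1 l rb * C.m la 0 1 (1 :: l :: rb) :=
    C.gen_comm la (.merge 0 1) [] (.split 1 l) rb
  have h₄ : C.m la 0 1 ((1 + l) :: rb) * C.o (1 :: la) ((1 + l) :: rb)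
      = C.m la 0 1 ((1 + l) :: rb) := C.gen_mul_one la (.merge 0 1) _
  have key : C.s la 0 1 ((1 + l) :: rb) * C.d la 0 (1 :: (1 + l) :: rb)
      * (C.m la 0 1 ((1 + l) :: rb) * (C.s (1 :: la) 1 l rb * C.m (1 :: la) 1 l rb)) = 0 := by
    linear_combination (norm := noncomm_ring) C.s (1 :: la) 1 l rb * h * C.m (1 :: la) 1 l rb
      + C.s la 0 1 ((1 + l) :: rb) * C.d la 0 (1 :: (1 + l) :: rb) * h₃ * C.m (1 :: la) 1 l rb
      + C.s la 0 1 ((1 + l) :: rb) * h₂ * C.m la 0 1 (1 :: l :: rb) * C.m (1 :: la) 1 l rb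
      + h₁ * C.d la 0 (1 :: 1 :: l :: rb) * C.m la 0 1 (1 :: l :: rb) * C.m (1 :: la) 1 l rb
  rw [hU, mul_smul_comm, h₄, mul_smul_comm] at key
  exact (nsmul_eq_zero_iff_right (Nat.succ_ne_zero l)).1 key

theorem zeroBetween (la : List ℕ) (m : ℕ) (rb : List ℕ) :
    ZeroBetween (C.o la (1 :: 1 :: m :: rb)) (C.d la 1 (1 :: m :: rb)) (C.d (1 :: la) 1 (m :: rb))
      (C.N la 1 1 (m :: rb)) (C.d la 1 (0 :: 1 :: m :: rb)) (C.d (0 :: 1 :: la) 1 (m :: rb))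
      (C.d (1 :: la) 0 (1 :: m :: rb)) (C.m la 1 0 (1 :: m :: rb))
      (C.m (1 :: la) 0 1 (m :: rb)) where
  tgt := C.dumbbellRel la (m :: rb)
  dd := (C.dot_dot (1 :: la) 0 (1 :: m :: rb)).trans (zero_smul ℕ _)
  b₁d := neg_eq_iff_eq_neg.1 (C.dot_anticomm la 1 [] 0 (1 :: m :: rb)).symm
  Le := C.gen_mul_one la (.merge 1 0) (1 :: m :: rb)
  Me := C.gen_mul_one (1 :: la) (.merge 0 1) (m :: rb)
  LX := by
    have h : C.m la 1 0 (1 :: m :: rb) * C.m la 1 1 (m :: rb)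
        = C.m (1 :: la) 0 1 (m :: rb) * C.m la 1 1 (m :: rb) := C.merge_assoc la 1 0 1 (m :: rb)
    rw [N, ← mul_assoc, h, mul_assoc]
  Lc₁ := C.merge_dot la 1 0 (1 :: m :: rb)
  Lc₂ := C.gen_comm la (.merge 1 0) [] (.dot 1) (m :: rb)
  Rc₁ := (C.gen_comm la (.dot 1) [] (.merge 0 1) (m :: rb)).symm
  Rc₂ := C.merge_dot (1 :: la) 0 1 (m :: rb)

/-- `N` on the last two of three strands, conjugated by a strand of thickness zero leaving and
rejoining the second of them, returns to itself. -/
theorem zero_sandwich [IsAddTorsionFree R] (la : List ℕ) (l : ℕ) (rb : List ℕ) :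
    C.s (1 :: la) 0 1 ((1 + l) :: rb) * C.N (0 :: 1 :: la) 1 (1 + l) rb
        * C.m (1 :: la) 0 1 ((1 + l) :: rb) = C.N (1 :: la) 1 (1 + l) rb :=
  (C.zeroBetween la (1 + l) rb).sandwich (C.s_mul_m_zero (1 :: la) 1 ((1 + l) :: rb))
    (C.zero_dot_bubble_eq_zero (1 :: la) l rb)
    (C.N_comm_left la (.merge 1 0) [] 1 (1 + l) rb).symm
    (C.N_comm_left (1 :: la) (.dot 0) [] 1 (1 + l) rb).symm
    (C.one_mul_N (1 :: la) 1 (1 + l) rb)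

/-- The square switch with a strand of thickness zero. -/
theorem zero_square_switch (la : List ℕ) (l : ℕ) (rb : List ℕ) :
    C.s la 0 1 ((1 + l) :: rb) * C.N (0 :: la) 1 (1 + l) rb * C.m la 0 1 ((1 + l) :: rb)
      = C.s (1 :: la) 1 l rb * C.N la 1 1 (l :: rb) * C.m (1 :: la) 1 l rb
        - l • C.o la (1 :: (1 + l) :: rb) := by
  have h : _ + _ = C.s (1 :: la) 1 l rb * C.N la 1 1 (l :: rb) * C.m (1 :: la) 1 l rb
      + 0 • C.o la (1 :: (1 + l) :: rb) := C.square_switch la 0 l rb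
  rw [zero_smul, add_zero] at h
  exact eq_sub_of_add_eq h

theorem N_eq [IsAddTorsionFree R] (la : List ℕ) (l : ℕ) (rb : List ℕ) :
    C.N (1 :: la) 1 (1 + l) rb
      = C.s (1 :: 1 :: la) 1 l rb * C.N (1 :: la) 1 1 (l :: rb) * C.m (1 :: 1 :: la) 1 l rb
        - l • C.o (1 :: la) (1 :: (1 + l) :: rb) := by
  rw [← zero_sandwich, zero_square_switch]

/-- The web `N` of type `(1, 1 + l)` with its second strand exploded into strands of thickness
one and `l`. -/
def V (la : List ℕ) (l : ℕ) (rb : List ℕ) : R :=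
  C.m (1 :: la) 1 l rb * C.N la 1 (1 + l) rb * C.s (1 :: la) 1 l rb

theorem N_mul_V (la : List ℕ) (l : ℕ) (rb : List ℕ) :
    C.N la 1 1 (l :: rb) * C.V la l rb = 2 * C.V la l rb := by
  have h : C.N la 1 1 (l :: rb) * (C.m (1 :: la) 1 l rb * C.m la 1 (1 + l) rb)
      = 2 • (C.m (1 :: la) 1 l rb * C.m la 1 (1 + l) rb) := C.N_left_mul_mm la 1 1 l rb
  rw [V, N.eq_1 C la 1 (1 + l)]
  linear_combination (norm := noncomm_ring) h * C.s la 1 (1 + l) rb * C.s (1 :: la) 1 l rb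

theorem V_mul_N (la : List ℕ) (l : ℕ) (rb : List ℕ) :
    C.V la l rb * C.N la 1 1 (l :: rb) = 2 * C.V la l rb := by
  have h : C.s la 1 (1 + l) rb * C.s (1 :: la) 1 l rb * C.N la 1 1 (l :: rb)
      = 2 • (C.s la 1 (1 + l) rb * C.s (1 :: la) 1 l rb) := C.ss_mul_N_left la 1 1 l rb
  rw [V, N.eq_1 C la 1 (1 + l)]
  linear_combination (norm := noncomm_ring) C.m (1 :: la) 1 l rb * C.m la 1 (1 + l) rb * h

theorem V_mul_d (la : List ℕ) (l : ℕ) (rb : List ℕ) :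
    C.V (0 :: la) l rb * C.d la 0 (1 :: 1 :: l :: rb)
      = C.d la 0 (1 :: 1 :: l :: rb) * C.V (0 :: la) l rb := by
  have h₁ : C.d la 0 (1 :: 1 :: l :: rb) * C.m (1 :: 0 :: la) 1 l rb
      = C.m (1 :: 0 :: la) 1 l rb * C.d la 0 (1 :: (1 + l) :: rb) :=
    C.gen_comm la (.dot 0) [1] (.merge 1 l) rb
  have h₂ : C.d la 0 (1 :: (1 + l) :: rb) * C.N (0 :: la) 1 (1 + l) rb
      = C.N (0 :: la) 1 (1 + l) rb * C.d la 0 (1 :: (1 + l) :: rb) :=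
    C.N_comm_left la (.dot 0) [] 1 (1 + l) rb
  have h₃ : C.d la 0 (1 :: (1 + l) :: rb) * C.s (1 :: 0 :: la) 1 l rb
      = C.s (1 :: 0 :: la) 1 l rb * C.d la 0 (1 :: 1 :: l :: rb) :=
    C.gen_comm la (.dot 0) [1] (.split 1 l) rb
  rw [V]
  linear_combination (norm := noncomm_ring)
    -h₁ * C.N (0 :: la) 1 (1 + l) rb * C.s (1 :: 0 :: la) 1 l rb
    - C.m (1 :: 0 :: la) 1 l rb * h₂ * C.s (1 :: 0 :: la) 1 l rb
    - C.m (1 :: 0 :: la) 1 l rb * C.N (0 :: la) 1 (1 + l) rb * h₃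

theorem s_mul_m_comm (la : List ℕ) (l : ℕ) (rb : List ℕ) :
    C.s la 0 1 (1 :: l :: rb) * C.m (1 :: 0 :: la) 1 l rb
      = C.m (1 :: la) 1 l rb * C.s la 0 1 ((1 + l) :: rb) :=
  C.gen_comm la (.split 0 1) [] (.merge 1 l) rb

theorem s_mul_m_comm' (la : List ℕ) (l : ℕ) (rb : List ℕ) :
    C.s (1 :: 0 :: la) 1 l rb * C.m la 0 1 (1 :: l :: rb)
      = C.m la 0 1 ((1 + l) :: rb) * C.s (1 :: la) 1 l rb :=
  (C.gen_comm la (.merge 0 1) [] (.split 1 l) rb).symm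

theorem S_V_M (la : List ℕ) (l : ℕ) (rb : List ℕ) :
    C.s la 0 1 (1 :: l :: rb) * C.V (0 :: la) l rb * C.m la 0 1 (1 :: l :: rb)
      = C.N (1 :: la) 1 l rb * C.N la 1 1 (l :: rb) * C.N (1 :: la) 1 l rb
        - l • C.N (1 :: la) 1 l rb := by
  have h := C.zero_square_switch la l rb
  have h₁ : C.m (1 :: la) 1 l rb * C.o la (1 :: (1 + l) :: rb) = C.m (1 :: la) 1 l rb :=
    C.gen_mul_one (1 :: la) (.merge 1 l) rb
  have h₂ : C.s la 0 1 (1 :: l :: rb) * C.V (0 :: la) l rb * C.m la 0 1 (1 :: l :: rb)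
      = C.m (1 :: la) 1 l rb
        * (C.s la 0 1 ((1 + l) :: rb) * C.N (0 :: la) 1 (1 + l) rb * C.m la 0 1 ((1 + l) :: rb))
        * C.s (1 :: la) 1 l rb := by
    rw [V]
    linear_combination (norm := noncomm_ring)
      C.s_mul_m_comm la l rb * C.N (0 :: la) 1 (1 + l) rb * C.s (1 :: 0 :: la) 1 l rb
          * C.m la 0 1 (1 :: l :: rb)
      + C.m (1 :: la) 1 l rb * C.s la 0 1 ((1 + l) :: rb) * C.N (0 :: la) 1 (1 + l) rb
          * C.s_mul_m_comm' la l rb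
  rw [h₂, h, mul_sub, mul_smul_comm, h₁, sub_mul, smul_mul_assoc, N.eq_1 C (1 :: la) 1 l]
  simp only [mul_assoc]

theorem two_sub_mul_S_V_M [IsAddTorsionFree R] (la : List ℕ) (l : ℕ) (rb : List ℕ) :
    (2 - C.N la 1 1 (l :: rb))
        * (C.s la 0 1 (1 :: l :: rb) * C.V (0 :: la) l rb * C.m la 0 1 (1 :: l :: rb))
      = (C.d la 1 (1 :: l :: rb) - C.d (1 :: la) 1 (l :: rb))
        * (C.s la 0 1 (1 :: l :: rb) * C.d la 0 (1 :: 1 :: l :: rb) * C.V (0 :: la) l rb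
            * C.m la 0 1 (1 :: l :: rb)) :=
  (C.zeroSplit la (l :: rb)).two_sub_mul (C.zeroMerge la (l :: rb)) (C.N_mul_V (0 :: la) l rb)

theorem braid_defect [IsAddTorsionFree R] (la rb : List ℕ) :
    (2 - C.N la 1 1 (1 :: rb))
      * (C.N (1 :: la) 1 1 rb * C.N la 1 1 (1 :: rb) * C.N (1 :: la) 1 1 rb
        - C.N (1 :: la) 1 1 rb) = 0 := by
  have hg := C.S_V_M la 1 rb
  rw [one_smul] at hg
  refine (C.dumbbellRel la (1 :: rb)).braid_defect_eq_zero (C.dumbbellRel (1 :: la) rb)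
    (C.N_comm_right la 1 1 [] (.dot 1) rb).symm (C.N_comm_left la (.dot 1) [] 1 1 rb) ?_
  have hk := (C.zeroMerge la (1 :: rb)).S_d_V_M_X (S := C.s la 0 1 (1 :: 1 :: rb))
    (C.V_mul_N (0 :: la) 1 rb) (C.V_mul_d la 1 rb)
  rw [← hg, two_sub_mul_S_V_M]
  linear_combination (norm := noncomm_ring)
    (C.d la 1 (1 :: 1 :: rb) - C.d (1 :: la) 1 (1 :: rb)) * hk

theorem two_mul_defect {n : ℕ} {e ν T U X Y Z : R} (hν : ν = T * Z * U - n • e)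
    (hTU : T * U = (n + 1) • e) (heν : e * ν = ν) (heX : e * X = X)
    (hZ : Z * (U * ν) = 2 * (U * ν)) (hU : Y * U = U * X) :
    2 * (ν * X * ν - (n + 1) • ν) = T * (Z * Y * Z - Z) * (U * ν) - n • (2 * (X * ν)) := by
  have h₁ : 2 * (ν * X * ν) = T * Z * Y * (2 * (U * ν)) - n • (2 * (X * ν)) := by
    have h : ν * X * ν = T * Z * U * X * ν - n • (e * X * ν) := by
      nth_rw 1 [hν]
      rw [sub_mul, sub_mul, smul_mul_assoc, smul_mul_assoc]
    rw [h, heX, mul_sub, mul_smul_comm]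
    linear_combination (norm := noncomm_ring) -2 * T * Z * hU * ν
  have h₂ : (n + 1) • ν = T * (U * ν) := by rw [← mul_assoc, hTU, smul_mul_assoc, heν]
  rw [h₂]
  linear_combination (norm := noncomm_ring) h₁ - T * Z * Y * hZ + T * hZ

theorem two_sub_mul_S_V_M_eq_zero [IsAddTorsionFree R] (la : List ℕ) (n : ℕ) (rb : List ℕ) :
    (2 - C.N la 1 1 ((1 + n) :: rb))
        * (C.s la 0 1 (1 :: (1 + n) :: rb) * C.V (0 :: la) (1 + n) rb
            * C.m la 0 1 (1 :: (1 + n) :: rb)) = 0 := by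
  have hN := C.N_eq la n rb
  have hTU := C.s_mul_m_one (1 :: 1 :: la) n rb
  have hb := C.braid_defect la (n :: rb)
  have hX : _ = (2 : ℕ) • _ := C.N_mul_N la 1 1 ((1 + n) :: rb)
  have heX := C.one_mul_N la 1 1 ((1 + n) :: rb)
  have heν : C.o (1 :: 1 :: la) ((1 + n) :: rb) * C.N (1 :: la) 1 (1 + n) rb = _ :=
    C.one_mul_N (1 :: la) 1 (1 + n) rb
  have hZ : C.N (1 :: la) 1 1 (n :: rb) * (C.m (1 :: 1 :: la) 1 n rb * C.N (1 :: la) 1 (1 + n) rb)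
      = 2 * (C.m (1 :: 1 :: la) 1 n rb * C.N (1 :: la) 1 (1 + n) rb) := by
    have h : C.N (1 :: la) 1 1 (n :: rb)
        * (C.m (1 :: 1 :: la) 1 n rb * C.m (1 :: la) 1 (1 + n) rb) = 2 • _ :=
      C.N_left_mul_mm (1 :: la) 1 1 n rb
    rw [N.eq_1 C (1 :: la) 1 (1 + n)]
    linear_combination (norm := noncomm_ring) h * C.s (1 :: la) 1 (1 + n) rb
  have hT : C.N la 1 1 ((1 + n) :: rb) * C.s (1 :: 1 :: la) 1 n rb
      = C.s (1 :: 1 :: la) 1 n rb * C.N la 1 1 (1 :: n :: rb) :=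
    C.N_comm_right la 1 1 [] (.split 1 n) rb
  have hU : C.N la 1 1 (1 :: n :: rb) * C.m (1 :: 1 :: la) 1 n rb
      = C.m (1 :: 1 :: la) 1 n rb * C.N la 1 1 ((1 + n) :: rb) :=
    C.N_comm_right la 1 1 [] (.merge 1 n) rb
  rw [S_V_M, Nat.add_comm 1 n]
  rw [Nat.add_comm 1 n] at *
  apply eq_of_two_mul_eq
  have h := two_mul_defect hN hTU heν heX hZ hU
  have hs : (2 - C.N la 1 1 ((n + 1) :: rb)) * (2 * (C.N la 1 1 ((n + 1) :: rb)
      * C.N (1 :: la) 1 (n + 1) rb)) = 0 := by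
    linear_combination (norm := noncomm_ring) -2 * hX * C.N (1 :: la) 1 (n + 1) rb
  rw [← mul_assoc, (Commute.ofNat_left 2 _).eq, mul_assoc, h, mul_sub, mul_smul_comm, hs,
    smul_zero]
  linear_combination (norm := noncomm_ring)
    C.s (1 :: 1 :: la) 1 n rb * hb * C.m (1 :: 1 :: la) 1 n rb * C.N (1 :: la) 1 (n + 1) rb
    - hT * (C.N (1 :: la) 1 1 (n :: rb) * C.N la 1 1 (1 :: n :: rb) * C.N (1 :: la) 1 1 (n :: rb)
      - C.N (1 :: la) 1 1 (n :: rb)) * C.m (1 :: 1 :: la) 1 n rb * C.N (1 :: la) 1 (n + 1) rb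

theorem zero_dot_N_eq_zero [IsAddTorsionFree R] (la : List ℕ) (l : ℕ) (rb : List ℕ) :
    C.s la 0 1 ((1 + l) :: rb) * C.d la 0 (1 :: (1 + l) :: rb) * C.N (0 :: la) 1 (1 + l) rb
      * C.m la 0 1 ((1 + l) :: rb) = 0 := by
  have hδ := C.zero_dot_bubble_eq_zero la l rb
  obtain _ | n := l
  · have h := (C.zeroMerge la rb).d_mul_YM
    have hδ : C.s la 0 1 (1 :: rb) * C.d la 0 (1 :: 1 :: rb) * C.m la 0 1 (1 :: rb) = 0 := hδ
    change C.s la 0 1 (1 :: rb) * C.d la 0 (1 :: 1 :: rb) * C.N (0 :: la) 1 1 rb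
      * C.m la 0 1 (1 :: rb) = 0
    linear_combination (norm := noncomm_ring) C.s la 0 1 (1 :: rb) * h + hδ * C.N la 1 1 rb
  rw [Nat.add_comm n 1]
  have h₀ := C.two_sub_mul_S_V_M_eq_zero la n rb
  generalize 1 + n = l at h₀ ⊢
  rw [two_sub_mul_S_V_M] at h₀
  have hu := (C.dumbbellRel la (l :: rb)).u_mul_u
  have he := (C.zeroSplit la (l :: rb)).eS
  have hκ : C.s la 0 1 (1 :: l :: rb) * C.d la 0 (1 :: 1 :: l :: rb) * C.V (0 :: la) l rb
      * C.m la 0 1 (1 :: l :: rb) = 0 := by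
    apply eq_of_two_mul_eq
    linear_combination (norm := noncomm_ring)
      (C.d la 1 (1 :: l :: rb) - C.d (1 :: la) 1 (l :: rb)) * h₀
      - hu * (C.s la 0 1 (1 :: l :: rb) * C.d la 0 (1 :: 1 :: l :: rb) * C.V (0 :: la) l rb
        * C.m la 0 1 (1 :: l :: rb))
      - 2 * he * C.d la 0 (1 :: 1 :: l :: rb) * C.V (0 :: la) l rb * C.m la 0 1 (1 :: l :: rb)
  have h₁ : C.d la 0 (1 :: 1 :: l :: rb) * C.m (1 :: 0 :: la) 1 l rb
      = C.m (1 :: 0 :: la) 1 l rb * C.d la 0 (1 :: (1 + l) :: rb) :=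
    C.gen_comm la (.dot 0) [1] (.merge 1 l) rb
  have h₂ := C.s_mul_m_comm la l rb
  have h₃ := C.s_mul_m_comm' la l rb
  have h₄ := C.s_mul_m_one (1 :: la) l rb
  have h₅ : C.m la 0 1 ((1 + l) :: rb) * C.o (1 :: la) ((1 + l) :: rb)
      = C.m la 0 1 ((1 + l) :: rb) := C.gen_mul_one la (.merge 0 1) _
  have h₆ : C.o (1 :: la) ((1 + l) :: rb) * C.s la 0 1 ((1 + l) :: rb)
      = C.s la 0 1 ((1 + l) :: rb) := C.one_mul_gen la (.split 0 1) _
  rw [V] at hκ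
  generalize hP : C.s la 0 1 ((1 + l) :: rb) * C.d la 0 (1 :: (1 + l) :: rb)
    * C.N (0 :: la) 1 (1 + l) rb * C.m la 0 1 ((1 + l) :: rb) = P
  have hP₁ : P * C.o (1 :: la) ((1 + l) :: rb) = P := by rw [← hP, mul_assoc, h₅]
  have hP₂ : C.o (1 :: la) ((1 + l) :: rb) * P = P := by
    rw [← hP]
    simp only [← mul_assoc]
    rw [h₆]
  have key : C.s (1 :: la) 1 l rb * C.m (1 :: la) 1 l rb * P
      * (C.s (1 :: la) 1 l rb * C.m (1 :: la) 1 l rb) = 0 := by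
    rw [← hP]
    linear_combination (norm := noncomm_ring) C.s (1 :: la) 1 l rb * hκ * C.m (1 :: la) 1 l rb
      - C.s (1 :: la) 1 l rb * C.s la 0 1 (1 :: l :: rb) * h₁ * C.N (0 :: la) 1 (1 + l) rb
        * C.s (1 :: 0 :: la) 1 l rb * C.m la 0 1 (1 :: l :: rb) * C.m (1 :: la) 1 l rb
      - C.s (1 :: la) 1 l rb * h₂ * C.d la 0 (1 :: (1 + l) :: rb) * C.N (0 :: la) 1 (1 + l) rb
        * C.s (1 :: 0 :: la) 1 l rb * C.m la 0 1 (1 :: l :: rb) * C.m (1 :: la) 1 l rb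
      - C.s (1 :: la) 1 l rb * C.m (1 :: la) 1 l rb * C.s la 0 1 ((1 + l) :: rb)
        * C.d la 0 (1 :: (1 + l) :: rb) * C.N (0 :: la) 1 (1 + l) rb * h₃ * C.m (1 :: la) 1 l rb
  rw [h₄, smul_mul_assoc, hP₂, mul_smul_comm, smul_mul_assoc, hP₁] at key
  have hl := Nat.succ_ne_zero l
  exact (nsmul_eq_zero_iff_right hl).1 ((nsmul_eq_zero_iff_right hl).1 key)

/-- A web `N` of type `(1, 1 + l)` with dots on its first strand above and below, between a split
and a merge of that strand with one of thickness `k`. -/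
theorem dotted_ladder [IsAddTorsionFree R] (la : List ℕ) (k l : ℕ) (rb : List ℕ) :
    C.s la k 1 ((1 + l) :: rb) * C.d (k :: la) 1 ((1 + l) :: rb) * C.N (k :: la) 1 (1 + l) rb
        * C.d (k :: la) 1 ((1 + l) :: rb) * C.m la k 1 ((1 + l) :: rb)
      = C.s la k 1 ((1 + l) :: rb) * C.s (1 :: k :: la) 1 l rb
          * (C.d (k :: la) 1 (1 :: l :: rb) * C.N (k :: la) 1 1 (l :: rb)
            * C.d (k :: la) 1 (1 :: l :: rb))
          * C.m (1 :: k :: la) 1 l rb * C.m la k 1 ((1 + l) :: rb)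
        - (l * (k + 1)) • C.o la ((k + 1) :: (1 + l) :: rb) := by
  have hS : C.s la k 1 ((1 + l) :: rb) * C.s la k 0 (1 :: (1 + l) :: rb)
      = C.s la k 1 ((1 + l) :: rb) * C.s (k :: la) 0 1 ((1 + l) :: rb) :=
    C.split_assoc la k 0 1 ((1 + l) :: rb)
  have hM : C.m la k 0 (1 :: (1 + l) :: rb) * C.m la k 1 ((1 + l) :: rb)
      = C.m (k :: la) 0 1 ((1 + l) :: rb) * C.m la k 1 ((1 + l) :: rb) :=
    C.merge_assoc la k 0 1 ((1 + l) :: rb)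
  have hc : C.d (k :: la) 1 ((1 + l) :: rb) * C.s (k :: la) 0 1 ((1 + l) :: rb)
      = C.s (k :: la) 0 1 ((1 + l) :: rb)
        * (C.d (k :: la) 0 (1 :: (1 + l) :: rb) + C.d (0 :: k :: la) 1 ((1 + l) :: rb)) :=
    C.dot_split (k :: la) 0 1 ((1 + l) :: rb)
  have hc' : C.m (k :: la) 0 1 ((1 + l) :: rb) * C.d (k :: la) 1 ((1 + l) :: rb)
      = (C.d (k :: la) 0 (1 :: (1 + l) :: rb) + C.d (0 :: k :: la) 1 ((1 + l) :: rb))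
        * C.m (k :: la) 0 1 ((1 + l) :: rb) :=
    C.merge_dot (k :: la) 0 1 ((1 + l) :: rb)
  have hL : C.m la k 0 (1 :: (1 + l) :: rb) * C.d (k :: la) 1 ((1 + l) :: rb)
      = C.d (0 :: k :: la) 1 ((1 + l) :: rb) * C.m la k 0 (1 :: (1 + l) :: rb) :=
    C.gen_comm la (.merge k 0) [] (.dot 1) ((1 + l) :: rb)
  have hL' : C.s la k 0 (1 :: (1 + l) :: rb) * C.d (0 :: k :: la) 1 ((1 + l) :: rb)
      = C.d (k :: la) 1 ((1 + l) :: rb) * C.s la k 0 (1 :: (1 + l) :: rb) :=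
    C.gen_comm la (.split k 0) [] (.dot 1) ((1 + l) :: rb)
  have hN : C.m la k 0 (1 :: (1 + l) :: rb) * C.N (k :: la) 1 (1 + l) rb
      = C.N (0 :: k :: la) 1 (1 + l) rb * C.m la k 0 (1 :: (1 + l) :: rb) :=
    C.N_comm_left la (.merge k 0) [] 1 (1 + l) rb
  have hd : C.d (k :: la) 0 (1 :: (1 + l) :: rb) * C.N (0 :: k :: la) 1 (1 + l) rb
      = C.N (0 :: k :: la) 1 (1 + l) rb * C.d (k :: la) 0 (1 :: (1 + l) :: rb) :=
    C.N_comm_left (k :: la) (.dot 0) [] 1 (1 + l) rb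
  have hdd : C.d (k :: la) 0 (1 :: (1 + l) :: rb) * C.d (k :: la) 0 (1 :: (1 + l) :: rb) = 0 :=
    (C.dot_dot (k :: la) 0 (1 :: (1 + l) :: rb)).trans (zero_smul ℕ _)
  have hLL : C.s la k 0 (1 :: (1 + l) :: rb) * C.m la k 0 (1 :: (1 + l) :: rb)
      = C.o (k :: la) (1 :: (1 + l) :: rb) := by
    rw [C.digon, Nat.choose_zero_right, one_smul]; rfl
  have heN := C.one_mul_N (k :: la) 1 (1 + l) rb
  have hP := C.zero_dot_N_eq_zero (k :: la) l rb
  have hQ := C.zero_square_switch (k :: la) l rb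
  have hT : C.d (k :: la) 1 ((1 + l) :: rb) * C.s (1 :: k :: la) 1 l rb
      = C.s (1 :: k :: la) 1 l rb * C.d (k :: la) 1 (1 :: l :: rb) :=
    C.gen_comm (k :: la) (.dot 1) [] (.split 1 l) rb
  have hU : C.d (k :: la) 1 (1 :: l :: rb) * C.m (1 :: k :: la) 1 l rb
      = C.m (1 :: k :: la) 1 l rb * C.d (k :: la) 1 ((1 + l) :: rb) :=
    C.gen_comm (k :: la) (.dot 1) [] (.merge 1 l) rb
  have hce : C.d (k :: la) 1 ((1 + l) :: rb) * C.o (k :: la) (1 :: (1 + l) :: rb)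
      = C.d (k :: la) 1 ((1 + l) :: rb) := C.gen_mul_one (k :: la) (.dot 1) _
  have hcc : C.d (k :: la) 1 ((1 + l) :: rb) * C.d (k :: la) 1 ((1 + l) :: rb)
      = C.o (k :: la) (1 :: (1 + l) :: rb) :=
    (C.dot_dot (k :: la) 1 ((1 + l) :: rb)).trans (one_smul ℕ _)
  have heM : C.o (k :: la) (1 :: (1 + l) :: rb) * C.m la k 1 ((1 + l) :: rb)
      = C.m la k 1 ((1 + l) :: rb) := C.one_mul_gen la (.merge k 1) _
  have hSM : C.s la k 1 ((1 + l) :: rb) * C.m la k 1 ((1 + l) :: rb)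
      = (k + 1) • C.o la ((k + 1) :: (1 + l) :: rb) := by
    rw [C.digon, Nat.choose_one_right]
  generalize C.s la k 1 ((1 + l) :: rb) = S at *
  generalize C.m la k 1 ((1 + l) :: rb) = M at *
  generalize C.m la k 0 (1 :: (1 + l) :: rb) = L at *
  generalize C.s la k 0 (1 :: (1 + l) :: rb) = L' at *
  generalize C.s (k :: la) 0 1 ((1 + l) :: rb) = P' at *
  generalize C.m (k :: la) 0 1 ((1 + l) :: rb) = P at *
  generalize C.d (k :: la) 1 ((1 + l) :: rb) = c at *
  generalize C.d (k :: la) 0 (1 :: (1 + l) :: rb) = d at *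
  generalize C.d (0 :: k :: la) 1 ((1 + l) :: rb) = c' at *
  generalize C.N (0 :: k :: la) 1 (1 + l) rb = N' at *
  generalize C.N (k :: la) 1 (1 + l) rb = N at *
  have h₁ : S * P' * c' * N' * c' * P * M = S * c * N * c * M := by
    linear_combination (norm := noncomm_ring) -hS * c' * N' * c' * P * M
      - S * L' * c' * N' * c' * hM + S * hL' * N' * c' * L * M - S * c * L' * N' * hL * M
      - S * c * L' * hN * c * M + S * c * hLL * N * c * M + S * c * heN * c * M
  have h₂ : S * c * (P' * N' * P) * c * M = S * P' * c' * N' * c' * P * M := by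
    linear_combination (norm := noncomm_ring) S * hc * N' * P * c * M
      + S * P' * c' * N' * hc' * M + S * hP * c * M - S * hc * N' * d * P * M
      - S * P' * hd * d * P * M - S * P' * N' * hdd * P * M
      - S * c * P' * hd * P * M + S * c * hP * M
  rw [← h₁, ← h₂, hQ, mul_sub, sub_mul, sub_mul, mul_smul_comm, mul_assoc S c (C.o (k :: la) _),
    hce, smul_mul_assoc, smul_mul_assoc, mul_assoc S c c, hcc, mul_assoc S (C.o _ _) M, heM,
    hSM, smul_smul]
  congr 1
  linear_combination (norm := noncomm_ring)
    S * hT * C.N (k :: la) 1 1 (l :: rb) * C.m (1 :: k :: la) 1 l rb * c * M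
    - S * C.s (1 :: k :: la) 1 l rb * C.d (k :: la) 1 (1 :: l :: rb)
      * C.N (k :: la) 1 1 (l :: rb) * hU * M

theorem _root_.WGen.rot_src (g : WGen) : g.rot.src = g.tgt.reverse := by
  cases g <;> simp [WGen.rot, WGen.src, WGen.tgt, Nat.add_comm]

theorem _root_.WGen.rot_tgt (g : WGen) : g.rot.tgt = g.src.reverse := by
  cases g <;> simp [WGen.rot, WGen.src, WGen.tgt, Nat.add_comm]

theorem _root_.WGen.rot_sgn_rot (g h : WGen) : h.rot.sgn g.rot = g.sgn h := by
  cases g <;> cases h <;> rfl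

open MulOpposite in
/-- Rotation of all webs by a half turn. -/
def rot : WebCalc Rᵐᵒᵖ where
  one w := op (C.one w.reverse)
  gen la g rb := op (C.gen rb g.rot la)
  one_mul_one w := congrArg op (C.one_mul_one _)
  one_mul_gen la g rb := by
    have h := C.gen_mul_one rb g.rot la
    rw [WGen.rot_tgt] at h
    rw [← op_mul]
    convert congrArg op h using 4
    simp
  gen_mul_one la g rb := by
    have h := C.one_mul_gen rb g.rot la
    rw [WGen.rot_src] at h
    rw [← op_mul]
    convert congrArg op h using 4
    simp
  exchange la g mid h rb := by
    have h := C.exchange rb h.rot mid.reverse g.rot la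
    simp only [WGen.rot_src, WGen.rot_tgt, WGen.rot_sgn_rot] at h
    simpa [-zsmul_eq_mul] using congrArg op h
  merge_assoc la h k l rb := by
    have h' := C.split_assoc rb l k h la
    rw [← op_mul, ← op_mul]
    simpa [WGen.rot, Nat.add_comm] using congrArg op h'.symm
  split_assoc la h k l rb := by
    have h' := C.merge_assoc rb l k h la
    rw [← op_mul, ← op_mul]
    simpa [WGen.rot, Nat.add_comm] using congrArg op h'.symm
  digon la k l rb := by
    have h := C.digon rb l k la
    rw [← Nat.choose_symm_add, Nat.add_comm] at h
    rw [← op_mul]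
    simpa [WGen.rot, -nsmul_eq_mul] using congrArg op h
  dot_dot la k rb := by
    have h := C.dot_dot rb k la
    rw [← op_mul]
    simpa [WGen.rot, -nsmul_eq_mul] using congrArg op h
  merge_dot la k l rb := by
    have h := C.dot_split rb l k la
    rw [Nat.add_comm l k, add_comm (C.gen rb _ _)] at h
    rw [← op_mul, ← op_add, ← op_mul]
    exact congrArg op h
  dot_split la k l rb := by
    have h := C.merge_dot rb l k la
    rw [Nat.add_comm l k, add_comm (C.gen rb _ _)] at h
    rw [← op_mul, ← op_add, ← op_mul]
    exact congrArg op h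
  dumbbell la rb := by
    have h := C.dumbbell rb la
    rw [two_mul] at h ⊢
    simpa [WGen.rot, mul_assoc] using congrArg op h
  square_switch la k l rb := by
    have h := C.square_switch rb l k la
    rw [eq_comm]
    simp only [← op_mul, ← op_add, ← op_smul]
    simpa [WGen.rot, Nat.add_comm, mul_assoc] using congrArg op h

theorem rot_N (la : List ℕ) (k l : ℕ) (rb : List ℕ) :
    C.rot.N la k l rb = MulOpposite.op (C.N rb l k la) := rfl

theorem rot_m (la : List ℕ) (k l : ℕ) (rb : List ℕ) :
    C.rot.m la k l rb = MulOpposite.op (C.s rb l k la) := rfl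

theorem rot_s (la : List ℕ) (k l : ℕ) (rb : List ℕ) :
    C.rot.s la k l rb = MulOpposite.op (C.m rb l k la) := rfl

theorem rot_d (la : List ℕ) (k : ℕ) (rb : List ℕ) :
    C.rot.d la k rb = MulOpposite.op (C.d rb k la) := rfl

theorem rot_o (la rb : List ℕ) :
    C.rot.o la rb = MulOpposite.op (C.one (la.reverseAux rb).reverse) := rfl

theorem dotted_ladder' [IsAddTorsionFree R] (la : List ℕ) (k l : ℕ) (rb : List ℕ) :
    C.s ((k + 1) :: la) 1 l rb * C.d ((k + 1) :: la) 1 (l :: rb) * C.N la (k + 1) 1 (l :: rb)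
        * C.d ((k + 1) :: la) 1 (l :: rb) * C.m ((k + 1) :: la) 1 l rb
      = C.s ((k + 1) :: la) 1 l rb * C.s la k 1 (1 :: l :: rb)
          * (C.d (1 :: k :: la) 1 (l :: rb) * C.N (k :: la) 1 1 (l :: rb)
            * C.d (1 :: k :: la) 1 (l :: rb))
          * C.m la k 1 (1 :: l :: rb) * C.m ((k + 1) :: la) 1 l rb
        - (k * (l + 1)) • C.o la ((k + 1) :: (1 + l) :: rb) := by
  have h := congrArg MulOpposite.unop (C.rot.dotted_ladder rb l k la)
  simp only [rot_N, rot_m, rot_s, rot_d, rot_o, MulOpposite.unop_mul, MulOpposite.unop_sub,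
    MulOpposite.unop_smul, MulOpposite.unop_op, Nat.add_comm 1 k] at h
  rw [Nat.add_comm 1 l]
  simpa only [o, mul_assoc, List.reverse_cons, List.append_assoc, List.reverseAux_eq,
    List.reverse_append, List.cons_append, List.nil_append, List.reverse_reverse] using h

/-- The square switch with dots on the rungs. -/
theorem dotted_square_switch [IsAddTorsionFree R] (la : List ℕ) (k l : ℕ) (rb : List ℕ) :
    C.s la k 1 ((1 + l) :: rb) * C.d (k :: la) 1 ((1 + l) :: rb) * C.N (k :: la) 1 (1 + l) rb
        * C.d (k :: la) 1 ((1 + l) :: rb) * C.m la k 1 ((1 + l) :: rb)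
      + C.s ((k + 1) :: la) 1 l rb * C.d ((k + 1) :: la) 1 (l :: rb) * C.N la (k + 1) 1 (l :: rb)
        * C.d ((k + 1) :: la) 1 (l :: rb) * C.m ((k + 1) :: la) 1 l rb
      = (k + 1 + (1 + l)) • C.o la ((k + 1) :: (1 + l) :: rb) := by
  have hs : C.s la k 1 ((1 + l) :: rb) * C.s (1 :: k :: la) 1 l rb
      = C.s ((k + 1) :: la) 1 l rb * C.s la k 1 (1 :: l :: rb) :=
    C.gen_comm la (.split k 1) [] (.split 1 l) rb
  have hm : C.m la k 1 (1 :: l :: rb) * C.m ((k + 1) :: la) 1 l rb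
      = C.m (1 :: k :: la) 1 l rb * C.m la k 1 ((1 + l) :: rb) :=
    C.gen_comm la (.merge k 1) [] (.merge 1 l) rb
  have hc := (C.dumbbellRel (k :: la) (l :: rb)).conj_add_conj
  have heU : C.o (k :: la) (1 :: 1 :: l :: rb) * C.m (1 :: k :: la) 1 l rb
      = C.m (1 :: k :: la) 1 l rb := C.one_mul_gen (1 :: k :: la) (.merge 1 l) rb
  have hTU := C.s_mul_m_one (1 :: k :: la) l rb
  have heM : C.o (1 :: k :: la) ((1 + l) :: rb) * C.m la k 1 ((1 + l) :: rb)
      = C.m la k 1 ((1 + l) :: rb) := C.one_mul_gen la (.merge k 1) _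
  have hSM : C.s la k 1 ((1 + l) :: rb) * C.m la k 1 ((1 + l) :: rb)
      = (k + 1) • C.o la ((k + 1) :: (1 + l) :: rb) := by
    rw [C.digon, Nat.choose_one_right]
  have key : C.s la k 1 ((1 + l) :: rb) * C.s (1 :: k :: la) 1 l rb
          * (C.d (k :: la) 1 (1 :: l :: rb) * C.N (k :: la) 1 1 (l :: rb)
            * C.d (k :: la) 1 (1 :: l :: rb))
          * C.m (1 :: k :: la) 1 l rb * C.m la k 1 ((1 + l) :: rb)
        + C.s ((k + 1) :: la) 1 l rb * C.s la k 1 (1 :: l :: rb)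
          * (C.d (1 :: k :: la) 1 (l :: rb) * C.N (k :: la) 1 1 (l :: rb)
            * C.d (1 :: k :: la) 1 (l :: rb))
          * C.m la k 1 (1 :: l :: rb) * C.m ((k + 1) :: la) 1 l rb
      = (2 * ((l + 1) * (k + 1))) • C.o la ((k + 1) :: (1 + l) :: rb) := by
    have hST : (l + 1) • (C.s la k 1 ((1 + l) :: rb) * C.m la k 1 ((1 + l) :: rb))
        = C.s la k 1 ((1 + l) :: rb) * C.s (1 :: k :: la) 1 l rb * C.m (1 :: k :: la) 1 l rb
          * C.m la k 1 ((1 + l) :: rb) := by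
      rw [mul_assoc _ (C.s (1 :: k :: la) 1 l rb), hTU, mul_smul_comm, smul_mul_assoc, mul_assoc,
        heM]
    rw [← hs, mul_assoc _ (C.m la k 1 _), hm, mul_assoc _ _ (C.m la k 1 _), ← add_mul, ← mul_add,
      hc, mul_smul, mul_smul, ← hSM, hST]
    linear_combination (norm := noncomm_ring) 2 * C.s la k 1 ((1 + l) :: rb)
      * C.s (1 :: k :: la) 1 l rb * heU * C.m la k 1 ((1 + l) :: rb)
  rw [dotted_ladder, dotted_ladder', sub_add_sub_comm, key, ← add_smul,
    show 2 * ((l + 1) * (k + 1)) = (k + 1 + (1 + l)) + (l * (k + 1) + k * (l + 1)) by ring,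
    add_smul, add_sub_cancel_right]

/-- Collision of two leftward rungs. -/
theorem leftward_rung_collision (la : List ℕ) (k r s t : ℕ) (rb : List ℕ) :
    C.s (k :: la) r (s + t) rb * C.m la k r ((s + t) :: rb)
        * (C.s ((k + r) :: la) s t rb * C.m la (k + r) s (t :: rb))
      = (r + s).choose s • (C.s (k :: la) (r + s) t rb * C.m la k (r + s) (t :: rb)) := by
  have hx : C.m la k r ((s + t) :: rb) * C.s ((k + r) :: la) s t rb
      = C.s (r :: k :: la) s t rb * C.m la k r (s :: t :: rb) :=
    C.gen_comm la (.merge k r) [] (.split s t) rb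
  have hs := C.split_assoc (k :: la) r s t rb
  have hm := C.merge_assoc la k r s (t :: rb)
  have hd := C.digon (k :: la) r s (t :: rb)
  have ho : C.o (k :: la) ((r + s) :: t :: rb) * C.m la k (r + s) (t :: rb)
      = C.m la k (r + s) (t :: rb) :=
    C.one_mul_gen la (.merge k (r + s)) (t :: rb)
  rw [← ho, ← mul_smul_comm, ← smul_mul_assoc, ← hd]
  linear_combination (norm := noncomm_ring)
    C.s (k :: la) r (s + t) rb * hx * C.m la (k + r) s (t :: rb)
    - hs * C.m la k r (s :: t :: rb) * C.m la (k + r) s (t :: rb)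
    + C.s (k :: la) (r + s) t rb * C.s (k :: la) r s (t :: rb) * hm

/-- Collision of two rightward rungs. -/
theorem rightward_rung_collision (la : List ℕ) (k r s t : ℕ) (rb : List ℕ) :
    C.s la (k + r) s (t :: rb) * C.m ((k + r) :: la) s t rb
        * (C.s la k r ((s + t) :: rb) * C.m (k :: la) r (s + t) rb)
      = (r + s).choose s • (C.s la k (r + s) (t :: rb) * C.m (k :: la) (r + s) t rb) := by
  have hx : C.s la k r (s :: t :: rb) * C.m (r :: k :: la) s t rb
      = C.m ((k + r) :: la) s t rb * C.s la k r ((s + t) :: rb) :=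
    C.gen_comm la (.split k r) [] (.merge s t) rb
  have hs := C.split_assoc la k r s (t :: rb)
  have hm := C.merge_assoc (k :: la) r s t rb
  have hd := C.digon (k :: la) r s (t :: rb)
  have ho : C.o (k :: la) ((r + s) :: t :: rb) * C.m (k :: la) (r + s) t rb
      = C.m (k :: la) (r + s) t rb :=
    C.one_mul_gen (k :: la) (.merge (r + s) t) rb
  rw [← ho, ← mul_smul_comm, ← smul_mul_assoc, ← hd]
  linear_combination (norm := noncomm_ring)
    -C.s la (k + r) s (t :: rb) * hx * C.m (k :: la) r (s + t) rb
    + hs * C.m (r :: k :: la) s t rb * C.m (k :: la) r (s + t) rb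
    - C.s la k (r + s) (t :: rb) * C.s (k :: la) r s (t :: rb) * hm

end Relations

end WebCalc

namespace QWebUp

/-- The `ℂ`-linear endomorphisms of the product of all morphism spaces. -/
abbrev WEnd (W : QWebUp) : Type := Module.End ℂ (∀ a b : WObj, W.Hom a b)

/-- Composition with a web, as an endomorphism of the product of all morphism spaces. -/
def act (W : QWebUp) {a b : WObj} (f : W.Hom a b) : W.WEnd where
  toFun v := fun a' x => if h : a = a' then h ▸ W.comp f (v b x) else 0
  map_add' u v := by
    funext a' x
    by_cases h : a = a'
    · subst h
      simp [W.comp_add_right]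
    · simp [h]
  map_smul' z v := by
    funext a' x
    by_cases h : a = a'
    · subst h
      simp [W.comp_smul_right]
    · simp [h]

variable (W : QWebUp)

theorem act_apply_self {a b : WObj} (f : W.Hom a b) (v : ∀ a b : WObj, W.Hom a b) (x : WObj) :
    W.act f v a x = W.comp f (v b x) := dif_pos rfl

theorem act_apply_of_ne {a b a' : WObj} (f : W.Hom a b) (v : ∀ a b : WObj, W.Hom a b)
    (x : WObj) (h : a ≠ a') : W.act f v a' x = 0 := dif_neg h

theorem act_comp {a b c : WObj} (f : W.Hom a b) (g : W.Hom b c) :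
    W.act (W.comp f g) = W.act f * W.act g := by
  refine LinearMap.ext fun v => funext fun a' => funext fun x => ?_
  by_cases ha : a = a'
  · subst ha
    rw [Module.End.mul_apply, act_apply_self, act_apply_self, act_apply_self, comp_assoc]
  · rw [Module.End.mul_apply, act_apply_of_ne W _ _ x ha, act_apply_of_ne W _ _ x ha]

theorem act_add {a b : WObj} (f g : W.Hom a b) : W.act (f + g) = W.act f + W.act g := by
  refine LinearMap.ext fun v => funext fun a' => funext fun x => ?_
  by_cases ha : a = a'
  · subst ha
    simp only [LinearMap.add_apply, Pi.add_apply, act_apply_self, comp_add_left]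
  · simp only [LinearMap.add_apply, Pi.add_apply, act_apply_of_ne W _ _ x ha, add_zero]

theorem act_smul {a b : WObj} (z : ℂ) (f : W.Hom a b) : W.act (z • f) = z • W.act f := by
  refine LinearMap.ext fun v => funext fun a' => funext fun x => ?_
  by_cases ha : a = a'
  · subst ha
    simp only [LinearMap.smul_apply, Pi.smul_apply, act_apply_self, comp_smul_left]
  · simp only [LinearMap.smul_apply, Pi.smul_apply, act_apply_of_ne W _ _ x ha, smul_zero]

theorem act_injective {a b : WObj} : Function.Injective (W.act : W.Hom a b → W.WEnd) := by
  intro f g h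
  classical
  have h' := congrFun (congrFun (LinearMap.congr_fun h
    fun c x => if e : c = x then e ▸ W.id c else 0) a) b
  simpa [act_apply_self, comp_id] using h'

theorem act_rc {a b a' b' : WObj} (ha : a = a') (hb : b = b') (f : W.Hom a b) :
    W.act (W.rc ha hb f) = W.act f := by
  subst ha hb
  rfl

theorem comp_tensor_id_left {a b c a' b' : WObj} (f : W.Hom a b) (g : W.Hom b c)
    (h : W.Hom a' b') :
    W.comp (W.tensor f (W.id a')) (W.tensor g h) = W.tensor (W.comp f g) h := by
  have hg : g ∈ W.par b c 0 ⊔ W.par b c 1 := W.par_cover b c ▸ Submodule.mem_top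
  obtain ⟨g₀, h₀, g₁, h₁, rfl⟩ := Submodule.mem_sup.1 hg
  have key : ∀ q, ∀ g ∈ W.par b c q,
      W.comp (W.tensor f (W.id a')) (W.tensor g h) = W.tensor (W.comp f g) h := by
    intro q g hg
    rw [W.tensor_interchange f g (W.id a') h 0 q (W.par_id a') hg, W.id_comp, zero_mul]
    simp
  rw [tensor_add_left, comp_add_right, comp_add_right, tensor_add_left, key 0 g₀ h₀, key 1 g₁ h₁]

theorem comp_tensor_id_right {a b a' b' c' : WObj} (f : W.Hom a b) (g : W.Hom a' b')
    (h : W.Hom b' c') :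
    W.comp (W.tensor f g) (W.tensor (W.id b) h) = W.tensor f (W.comp g h) := by
  have hg : g ∈ W.par a' b' 0 ⊔ W.par a' b' 1 := W.par_cover a' b' ▸ Submodule.mem_top
  obtain ⟨g₀, h₀, g₁, h₁, rfl⟩ := Submodule.mem_sup.1 hg
  have key : ∀ q, ∀ g ∈ W.par a' b' q,
      W.comp (W.tensor f g) (W.tensor (W.id b) h) = W.tensor f (W.comp g h) := by
    intro q g hg
    rw [W.tensor_interchange f (W.id b) g h q 0 hg (W.par_id b), W.comp_id, mul_zero]
    simp
  rw [tensor_add_right, comp_add_left, comp_add_left, tensor_add_right, key 0 g₀ h₀, key 1 g₁ h₁]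

/-- A web with the identity strands `la` (listed from right to left) on its left and `rb` on its
right. -/
def ctx (W : QWebUp) : List ℕ → List ℕ → ∀ {a b : WObj}, W.Hom a b → W.WEnd
  | [], [], _, _, f => W.act f
  | h :: la, [], _, _, f => ctx W la [] (W.tensor (W.id [h]) f)
  | la, r :: rb, _, _, f => ctx W la rb (W.tensor f (W.id [r]))
termination_by la rb => (rb.length, la.length)

theorem ctx_nil_nil {a b : WObj} (f : W.Hom a b) : W.ctx [] [] f = W.act f := by rw [ctx]

theorem ctx_cons_right (la : List ℕ) (r : ℕ) (rb : List ℕ) {a b : WObj} (f : W.Hom a b) :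
    W.ctx la (r :: rb) f = W.ctx la rb (W.tensor f (W.id [r])) := by rw [ctx]

theorem ctx_congr (la rb : List ℕ) {a b a' b' : WObj} (ha : a = a') (hb : b = b')
    {f : W.Hom a b} {g : W.Hom a' b'} (h : HEq f g) : W.ctx la rb f = W.ctx la rb g := by
  subst ha hb
  rw [eq_of_heq h]

theorem ctx_cons_left (h : ℕ) (la rb : List ℕ) {a b : WObj} (f : W.Hom a b) :
    W.ctx (h :: la) rb f = W.ctx la rb (W.tensor (W.id [h]) f) := by
  induction rb generalizing a b with
  | nil => rw [ctx]
  | cons r rb ih =>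
    rw [ctx_cons_right, ctx_cons_right, ih]
    exact W.ctx_congr la rb rfl rfl (W.rel_tensor_assoc _ _ _).symm

theorem ctx_append_right (la : List ℕ) (r : ℕ) (t rb : List ℕ) {a b : WObj} (f : W.Hom a b) :
    W.ctx la (r :: t ++ rb) f = W.ctx la rb (W.tensor f (W.id (r :: t))) := by
  induction t generalizing a b r with
  | nil => exact W.ctx_cons_right la r rb f
  | cons t₀ t ih =>
    rw [List.cons_append, ctx_cons_right, ih]
    refine W.ctx_congr la rb (List.append_assoc _ _ _) (List.append_assoc _ _ _) ?_
    exact (W.rel_tensor_assoc _ _ _).trans (by rw [tensor_id]; rfl)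

theorem ctx_append_left (h : ℕ) (t la rb : List ℕ) {a b : WObj} (f : W.Hom a b) :
    W.ctx ((h :: t).reverseAux la) rb f = W.ctx la rb (W.tensor (W.id (h :: t)) f) := by
  induction t generalizing la h with
  | nil => exact W.ctx_cons_left h la rb f
  | cons t₀ t ih =>
    rw [List.reverseAux_cons, ih, ctx_cons_left]
    refine W.ctx_congr la rb rfl rfl ((W.rel_tensor_assoc _ _ _).symm.trans ?_)
    rw [tensor_id]
    rfl

theorem ctx_comp (la rb : List ℕ) {a b c : WObj} (f : W.Hom a b) (g : W.Hom b c) :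
    W.ctx la rb (W.comp f g) = W.ctx la rb f * W.ctx la rb g := by
  induction rb generalizing a b c with
  | cons r rb ih => rw [ctx_cons_right, ctx_cons_right, ctx_cons_right, ← ih, comp_tensor_id_left]
  | nil =>
    induction la generalizing a b c with
    | nil => simp only [ctx_nil_nil, act_comp]
    | cons h la ih => rw [ctx_cons_left, ctx_cons_left, ctx_cons_left, ← ih, comp_tensor_id_right]

theorem ctx_add (la rb : List ℕ) {a b : WObj} (f g : W.Hom a b) :
    W.ctx la rb (f + g) = W.ctx la rb f + W.ctx la rb g := by
  induction rb generalizing a b with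
  | cons r rb ih => rw [ctx_cons_right, ctx_cons_right, ctx_cons_right, ← ih, tensor_add_left]
  | nil =>
    induction la generalizing a b with
    | nil => simp only [ctx_nil_nil, act_add]
    | cons h la ih => rw [ctx_cons_left, ctx_cons_left, ctx_cons_left, ← ih, tensor_add_right]

theorem ctx_smul (la rb : List ℕ) {a b : WObj} (z : ℂ) (f : W.Hom a b) :
    W.ctx la rb (z • f) = z • W.ctx la rb f := by
  induction rb generalizing a b with
  | cons r rb ih => rw [ctx_cons_right, ctx_cons_right, ← ih, tensor_smul_left]
  | nil =>
    induction la generalizing a b with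
    | nil => simp only [ctx_nil_nil, act_smul]
    | cons h la ih => rw [ctx_cons_left, ctx_cons_left, ← ih, tensor_smul_right]

theorem ctx_id (la rb w : List ℕ) :
    W.ctx la rb (W.id w) = W.act (W.id (la.reverseAux (w ++ rb))) := by
  induction rb generalizing w with
  | cons r rb ih => rw [ctx_cons_right, tensor_id, ih, List.append_assoc]; rfl
  | nil =>
    rw [List.append_nil]
    induction la generalizing w with
    | nil => rw [ctx_nil_nil]; rfl
    | cons h la ih => rw [ctx_cons_left, tensor_id, ih]; rfl

theorem ctx_exchange (la rb : List ℕ) {x y x' y' : ℕ} {a b a' b' : WObj}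
    {f : W.Hom (x :: a) (y :: b)} {h : W.Hom (x' :: a') (y' :: b')} {p q : ZMod 2}
    (hf : f ∈ W.par _ _ p) (hh : h ∈ W.par _ _ q) :
    W.ctx la (x' :: a' ++ rb) f * W.ctx ((y :: b).reverseAux la) rb h
      = (-1 : ℂ) ^ (p * q).val •
        (W.ctx ((x :: a).reverseAux la) rb h * W.ctx la (y' :: b' ++ rb) f) := by
  have h₁ := W.tensor_interchange (W.id (x :: a)) f h (W.id (y' :: b')) q p hh hf
  rw [W.id_comp, W.comp_id] at h₁
  rw [ctx_append_right, ctx_append_left, ctx_append_left, ctx_append_right, ← ctx_comp, ← ctx_comp,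
    comp_tensor_id_right, W.id_comp, h₁, ctx_smul, smul_smul, mul_comm q p, ← mul_pow]
  norm_num

/-- The generating webs as morphisms. -/
def web : ∀ g : WGen, W.Hom g.src g.tgt
  | .merge k l => W.merge k l
  | .split k l => W.split k l
  | .dot k => W.dot k

/-- The parity of the generating webs. -/
def _root_.WGen.parity : WGen → ZMod 2
  | .merge _ _ => 0
  | .split _ _ => 0
  | .dot _ => 1

theorem web_mem_par (g : WGen) : W.web g ∈ W.par g.src g.tgt g.parity := by
  cases g
  · exact W.par_merge _ _
  · exact W.par_split _ _
  · exact W.par_dot _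

theorem neg_one_pow_parity (g h : WGen) :
    (-1 : ℂ) ^ (g.parity * h.parity).val = (g.sgn h : ℂ) := by
  cases g <;> cases h <;> simp [WGen.parity, WGen.sgn, ZMod.val_one]

theorem natCast_smul_WEnd (n : ℕ) (T : W.WEnd) : ((n : ℕ) : ℂ) • T = n • T :=
  Nat.cast_smul_eq_nsmul ℂ n T

theorem add_nsmul_eq_add_nsmul (k l : ℕ) {S T e : W.WEnd}
    (h : S = (((k : ℂ) + 1) - ((l : ℂ) + 1)) • e + T) : S + l • e = T + k • e := by
  rw [h, ← natCast_smul_WEnd, ← natCast_smul_WEnd]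
  module

theorem ctx_web_exchange (la : List ℕ) (g : WGen) (mid : List ℕ) (h : WGen) (rb : List ℕ) :
    W.ctx la (mid ++ (h.src ++ rb)) (W.web g)
        * W.ctx ((g.tgt ++ mid).reverseAux la) rb (W.web h)
      = g.sgn h • (W.ctx ((g.src ++ mid).reverseAux la) rb (W.web h)
        * W.ctx la (mid ++ (h.tgt ++ rb)) (W.web g)) := by
  have key : ∀ {x y : ℕ} {a b : WObj} {f : W.Hom (x :: a) (y :: b)},
      f ∈ W.par _ _ g.parity →
      W.ctx la (h.src ++ rb) f * W.ctx ((y :: b).reverseAux la) rb (W.web h)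
        = g.sgn h • (W.ctx ((x :: a).reverseAux la) rb (W.web h) * W.ctx la (h.tgt ++ rb) f) := by
    intro x y a b f hf
    have hh := W.web_mem_par h
    rw [← Int.cast_smul_eq_zsmul ℂ, ← neg_one_pow_parity]
    cases h <;> exact W.ctx_exchange la rb hf hh
  have hg := W.web_mem_par g
  cases mid with
  | nil =>
    rw [List.append_nil, List.append_nil]
    cases g <;> exact key hg
  | cons c mid =>
    have hgm := W.par_tensor hg (W.par_id (c :: mid))
    rw [add_zero] at hgm
    have e : ∀ u, W.ctx la (c :: mid ++ u) (W.web g)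
        = W.ctx la u (W.tensor (W.web g) (W.id (c :: mid))) :=
      fun u => W.ctx_append_right la c mid u _
    rw [e, e]
    cases g <;> exact key hgm

/-- The generating webs act on the product of all morphism spaces. -/
def webCalc : WebCalc W.WEnd where
  one w := W.act (W.id w)
  gen la g rb := W.ctx la rb (W.web g)
  one_mul_one w := by rw [← act_comp, id_comp]
  one_mul_gen la g rb := by rw [← ctx_id, ← ctx_comp, id_comp]
  gen_mul_one la g rb := by rw [← ctx_id, ← ctx_comp, comp_id]
  exchange := W.ctx_web_exchange
  merge_assoc la h k l rb := by
    rw [ctx_cons_right, ctx_cons_left]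
    exact (W.ctx_comp la rb _ _).symm.trans ((W.ctx_congr la rb rfl (by rw [Nat.add_assoc])
      (W.rel_merge_assoc h k l)).trans (W.ctx_comp la rb _ _))
  split_assoc la h k l rb := by
    rw [ctx_cons_right, ctx_cons_left]
    exact (W.ctx_comp la rb _ _).symm.trans ((W.ctx_congr la rb (by rw [Nat.add_assoc]) rfl
      (W.rel_split_assoc h k l)).trans (W.ctx_comp la rb _ _))
  digon la k l rb := by
    have h := congrArg (W.ctx la rb) (W.rel_digon k l)
    rwa [ctx_comp, ctx_smul, ctx_id, natCast_smul_WEnd] at h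
  dot_dot la k rb := by
    have h := congrArg (W.ctx la rb) (W.rel_dot_dot k)
    rwa [ctx_comp, ctx_smul, ctx_id, natCast_smul_WEnd] at h
  merge_dot la k l rb := by
    have h := congrArg (W.ctx la rb) (W.rel_dots_merge k l)
    rw [ctx_comp, ctx_add, ctx_comp, ctx_comp, ← add_mul] at h
    rw [ctx_cons_right, ctx_cons_left]
    exact h
  dot_split la k l rb := by
    have h := congrArg (W.ctx la rb) (W.rel_dots_split k l)
    rw [ctx_comp, ctx_add, ctx_comp, ctx_comp, ← mul_add] at h
    rw [ctx_cons_right, ctx_cons_left]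
    exact h
  dumbbell la rb := by
    have hd : W.tensor (W.dot 1) (W.dot 1)
        = W.comp (W.tensor (W.dot 1) (W.id [1])) (W.tensor (W.id [1]) (W.dot 1)) := by
      rw [comp_tensor_id_right, id_comp]
    have h := congrArg (W.ctx la rb) W.rel_dumbbell
    rw [hd] at h
    rw [ctx_add, ctx_smul, ctx_id, ctx_comp, ctx_comp, ctx_comp, ctx_comp, ← mul_assoc] at h
    rw [ctx_cons_right, ctx_cons_left, two_mul, ← two_smul ℂ]
    refine h.trans ?_
    have e := W.ctx_comp la rb (W.tensor (W.dot 1) (W.id [1])) (W.tensor (W.id [1]) (W.dot 1))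
    have e' := W.ctx_comp la rb (W.merge 1 1) (W.split 1 1)
    exact congrArg (· + _) (congrArg₂ (· * ·) (congrArg₂ (· * ·) rfl e') e)
  square_switch la k l rb := by
    have h := congrArg (W.ctx la rb) (sub_eq_iff_eq_add.1 (W.rel_square_switch k l))
    rw [ctx_add, ctx_smul, ctx_id] at h
    simp only [ctx_comp] at h
    simp only [ctx_cons_right, ctx_cons_left]
    refine W.add_nsmul_eq_add_nsmul k l ((Eq.trans ?_ h).trans ?_)
    · simp only [mul_assoc]
      rfl
    · simp only [mul_assoc]
      rfl

instance : IsAddTorsionFree W.WEnd where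
  nsmul_right_injective n hn S T h := by
    simp only [← natCast_smul_WEnd] at h
    exact smul_right_injective _ (Nat.cast_ne_zero.2 hn) h

theorem act_rungL (k r t : ℕ) :
    W.act (W.rungL k r t) = W.webCalc.s [k] r t [] * W.webCalc.m [] k r [t] := by
  simp only [WebCalc.s, WebCalc.m, webCalc, ctx_cons_left, ctx_cons_right, ctx_nil_nil]
  exact W.act_comp _ _

theorem act_rungR (r k t : ℕ) :
    W.act (W.rungR r k t) = W.webCalc.s [] k r [t] * W.webCalc.m [k] r t [] := by
  simp only [WebCalc.s, WebCalc.m, webCalc, ctx_cons_left, ctx_cons_right, ctx_nil_nil]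
  exact W.act_comp _ _

theorem act_rungLdot (k t : ℕ) :
    W.act (W.rungLdot k t)
      = W.webCalc.s [k] 1 t [] * W.webCalc.d [k] 1 [t] * W.webCalc.m [] k 1 [t] := by
  simp only [WebCalc.s, WebCalc.m, WebCalc.d, webCalc, ctx_cons_right]
  rw [ctx_cons_left, ← ctx_cons_right, ctx_cons_left, ctx_cons_right, mul_assoc]
  simp only [ctx_nil_nil]
  exact (W.act_comp _ _).trans (congrArg _ (W.act_comp _ _))

theorem act_rungRdot (k t : ℕ) :
    W.act (W.rungRdot k t)
      = W.webCalc.s [] k 1 [t] * W.webCalc.d [k] 1 [t] * W.webCalc.m [k] 1 t [] := by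
  have hd : W.webCalc.d [k] 1 [t]
      = W.act (W.tensor (W.tensor (W.id [k]) (W.dot 1)) (W.id [t])) := by
    simp only [WebCalc.d, webCalc]
    rw [ctx_cons_left, ctx_cons_right, ctx_nil_nil]
    rfl
  rw [hd, mul_assoc]
  simp only [WebCalc.s, WebCalc.m, webCalc, ctx_cons_left, ctx_cons_right, ctx_nil_nil]
  exact (W.act_comp _ _).trans (congrArg _ (W.act_comp _ _))

end QWebUp

open QWebUp in
/-- Lemma 4.3(a),(b) of Brown–Kujawa, "Webs of type Q".
(a) Two successive rungs of thicknesses `r` and `s` in the same direction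
between a pair of adjacent strands compose to `binom(r+s,s)` times the single
rung of thickness `r+s` (for both orientations of the rungs);
(b) on `↑_{k+1} ↑_{1+l}`, the two composites of a dotted rightward rung of
thickness 1 and a dotted leftward rung of thickness 1, taken in both orders,
sum to `(k+l+2)·id`. -/
theorem qweb_rung_collision_and_dotted_square_switch (W : QWebUp) :
    (∀ k r s t : ℕ,
        W.comp (rungL W k r (s + t)) (rungL W (k + r) s t)
          = (((r + s).choose s : ℕ) : ℂ) •
              W.rc (by rw [Nat.add_assoc]) (by rw [Nat.add_assoc])
                (rungL W k (r + s) t))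
    ∧ (∀ k r s t : ℕ,
        W.comp (rungR W s (k + r) t) (rungR W r k (s + t))
          = (((r + s).choose s : ℕ) : ℂ) •
              W.rc (by rw [Nat.add_assoc]) (by rw [Nat.add_assoc])
                (rungR W (r + s) k t))
    ∧ (∀ k l : ℕ,
        W.comp (rungRdot W k (1 + l)) (rungLdot W k (1 + l))
          + W.comp (rungLdot W (k + 1) l) (rungRdot W (k + 1) l)
        = ((((k + 1) + (1 + l) : ℕ)) : ℂ) • W.id [k + 1, 1 + l]) := by
  refine ⟨fun k r s t => W.act_injective ?_, fun k r s t => W.act_injective ?_,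
    fun k l => W.act_injective ?_⟩
  · rw [act_smul, act_rc, act_comp, act_rungL, act_rungL, act_rungL, natCast_smul_WEnd]
    exact W.webCalc.leftward_rung_collision [] k r s t []
  · rw [act_smul, act_rc, act_comp, act_rungR, act_rungR, act_rungR, natCast_smul_WEnd]
    exact W.webCalc.rightward_rung_collision [] k r s t []
  · rw [act_smul, act_add, act_comp, act_comp, act_rungRdot, act_rungLdot, act_rungLdot,
      act_rungRdot, natCast_smul_WEnd]
    have h := W.webCalc.dotted_square_switch [] k l []
    simp only [WebCalc.N, mul_assoc] at h ⊢
    exact h
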